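/- Theorem (Mañé's theorem for induced maps). Let 𝒩⁰, 𝒥 and T : 𝒥 → [0,1] satisfy conditions (1)–(3). Then T is hyperbolic: there exist constants C > 0 and κ > 1 such that for every x and every n ≥ 1 with x, T(x), …, T^{n−1}(x) all in 𝒥, one has |DT^n(x)| ≥ C·κ^n. -/

import Mathlib

open MeasureTheory Set Filter

noncomputable section

/-- The setting of Mañé's theorem for induced maps: a family `𝒩⁰` of pairwise disjoint
compact subintervals of `(0,1)` with nonempty interior, and a map `T : 𝒥 → [0,1]`
(`𝒥 = ⋃ 𝒩⁰`) such that: (1) `T` restricted to each `J ∈ 𝒩⁰` is a `C¹` diffeomorphism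
onto `[0,1]`; (2) `T` has `D_d`-bounded distortion on each `J ∈ 𝒩⁰`; (3) every periodic
orbit of `T` (of minimal period `q`) is hyperbolic repelling. -/
structure InducedSetup where
  /-- the family `𝒩⁰` of intervals -/
  Nfam : Set (Set ℝ)
  /-- the induced map, given as a global map whose relevant values are those on `𝒥` -/
  T : ℝ → ℝ
  /-- the distortion constant `D_d` -/
  Dd : ℝ
  hN : ∀ J ∈ Nfam, IsCompact J ∧ J.OrdConnected ∧ (interior J).Nonempty ∧ J ⊆ Set.Ioo 0 1
  hdisj : Nfam.Pairwise Disjoint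
  hdiffeo : ∀ J ∈ Nfam, Set.BijOn T J (Set.Icc 0 1) ∧
    (∀ x ∈ J, DifferentiableAt ℝ T x ∧ deriv T x ≠ 0) ∧ ContinuousOn (deriv T) J
  hDd : 0 < Dd
  hdist : ∀ J ∈ Nfam, ∀ x ∈ J, ∀ y ∈ J, deriv T x / deriv T y ≤ 1 + Dd * |T x - T y|
  hper : ∀ (x : ℝ) (q : ℕ), 1 ≤ q → (∀ k < q, T^[k] x ∈ ⋃₀ Nfam) → T^[q] x = x →
    (∀ k, 0 < k → k < q → T^[k] x ≠ x) →
    1 < |∏ k ∈ Finset.range q, deriv T (T^[k] x)|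

/-- The domain `𝒥 = ⋃_{J ∈ 𝒩⁰} J` of the induced map. -/
def InducedSetup.J (S : InducedSetup) : Set ℝ := ⋃₀ S.Nfam

/-- The derivative `DT^n` of the `n`-th iterate of `T`, written via the chain rule as
the product of the derivatives of `T` along the orbit. -/
noncomputable def derIter (T : ℝ → ℝ) (n : ℕ) (x : ℝ) : ℝ :=
  ∏ k ∈ Finset.range n, deriv T (T^[k] x)

/-- The set `⋂_{k=0}^{n-1} T^{-k}(𝒥)` of points whose first `n` iterates stay in `𝒥`. -/
def InducedSetup.inter (S : InducedSetup) (n : ℕ) : Set ℝ :=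
  ⋂ k ∈ Finset.range n, S.T^[k] ⁻¹' S.J

/-- `e_n`: the supremum of the lengths of the connected components of
`⋂_{k=0}^{n-1} T^{-k}(𝒥)`. -/
noncomputable def InducedSetup.eN (S : InducedSetup) (n : ℕ) : ℝ :=
  sSup ((fun x => (volume (connectedComponentIn (S.inter n) x)).toReal) '' S.inter n)

namespace InducedSetup

variable (S : InducedSetup)

/-- The first `n` points of the orbit of `x` lie in the domain of the induced map. -/
def Stays (n : ℕ) (x : ℝ) : Prop := ∀ k < n, S.T^[k] x ∈ S.J

/-- The pullback of `C` by the inverse branch of `T^n` along the orbit of `x`. -/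
def pull (n : ℕ) (x : ℝ) (C : Set ℝ) : Set ℝ :=
  {z | (∀ k < n, ∃ J ∈ S.Nfam, S.T^[k] x ∈ J ∧ S.T^[k] z ∈ J) ∧ S.T^[n] z ∈ C}

/-- The cylinder of level `n` containing `x`. -/
def cyl (n : ℕ) (x : ℝ) : Set ℝ := S.pull n x (Icc 0 1)

/-- The total length of the images under `T, …, T^n` of the cylinder of level `n`
containing `x`. -/
def lenSum (n : ℕ) (x : ℝ) : ℝ :=
  ∑ i ∈ Finset.range n, volume.real (S.cyl (n - 1 - i) (S.T^[i + 1] x))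

/-! ### A single branch -/

variable {S}

lemma eq_of_mem {J J' : Set ℝ} (hJ : J ∈ S.Nfam) (hJ' : J' ∈ S.Nfam) {x : ℝ} (hx : x ∈ J)
    (hx' : x ∈ J') : J = J' := by
  by_contra hne
  exact Set.disjoint_left.1 (S.hdisj hJ hJ' hne) hx hx'

lemma continuousAt_T {x : ℝ} (hx : x ∈ S.J) : ContinuousAt S.T x := by
  obtain ⟨J, hJ, hxJ⟩ := hx
  exact ((S.hdiffeo J hJ).2.1 x hxJ).1.continuousAt

lemma continuousOn_T {J : Set ℝ} (hJ : J ∈ S.Nfam) : ContinuousOn S.T J :=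
  fun _ hx => (continuousAt_T ⟨J, hJ, hx⟩).continuousWithinAt

lemma isPreconnected_branch {J : Set ℝ} (hJ : J ∈ S.Nfam) : IsPreconnected J :=
  isPreconnected_iff_ordConnected.2 (S.hN J hJ).2.1

lemma deriv_pos_or_neg {J : Set ℝ} (hJ : J ∈ S.Nfam) :
    (∀ x ∈ J, 0 < deriv S.T x) ∨ (∀ x ∈ J, deriv S.T x < 0) := by
  have hc := (S.hdiffeo J hJ).2.2
  have hne : ∀ x ∈ J, deriv S.T x ≠ 0 := fun x hx => ((S.hdiffeo J hJ).2.1 x hx).2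
  by_contra! h
  obtain ⟨⟨x, hx, hx0⟩, y, hy, hy0⟩ := h
  have := (isPreconnected_branch hJ).intermediate_value hx hy hc ⟨hx0, hy0⟩
  obtain ⟨z, hz, hz0⟩ := this
  exact hne z hz hz0

lemma deriv_mul_deriv_pos {J : Set ℝ} (hJ : J ∈ S.Nfam) {x y : ℝ} (hx : x ∈ J) (hy : y ∈ J) :
    0 < deriv S.T x * deriv S.T y := by
  rcases deriv_pos_or_neg hJ with h | h
  · exact mul_pos (h x hx) (h y hy)
  · exact mul_pos_of_neg_of_neg (h x hx) (h y hy)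

lemma strictMonoOn_or_strictAntiOn {J : Set ℝ} (hJ : J ∈ S.Nfam) :
    StrictMonoOn S.T J ∨ StrictAntiOn S.T J := by
  have hconv : Convex ℝ J := (S.hN J hJ).2.1.convex
  rcases deriv_pos_or_neg hJ with h | h
  · exact Or.inl (strictMonoOn_of_deriv_pos hconv (continuousOn_T hJ)
      fun x hx => h x (interior_subset hx))
  · exact Or.inr (strictAntiOn_of_deriv_neg hconv (continuousOn_T hJ)
      fun x hx => h x (interior_subset hx))

lemma ordConnected_inter_preimage {J : Set ℝ} (hJ : J ∈ S.Nfam) {C : Set ℝ}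
    (hC : C.OrdConnected) : (J ∩ S.T ⁻¹' C).OrdConnected := by
  refine ⟨fun x hx y hy z hz => ?_⟩
  have hzJ : z ∈ J := (S.hN J hJ).2.1.out hx.1 hy.1 hz
  refine ⟨hzJ, ?_⟩
  rcases strictMonoOn_or_strictAntiOn hJ with h | h
  · exact hC.out hx.2 hy.2 ⟨h.monotoneOn hx.1 hzJ hz.1, h.monotoneOn hzJ hy.1 hz.2⟩
  · exact hC.out hy.2 hx.2 ⟨h.antitoneOn hzJ hy.1 hz.2, h.antitoneOn hx.1 hzJ hz.1⟩

lemma abs_deriv_le {J : Set ℝ} (hJ : J ∈ S.Nfam) {x y : ℝ} (hx : x ∈ J) (hy : y ∈ J) :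
    |deriv S.T x| ≤ |deriv S.T y| * (1 + S.Dd * |S.T x - S.T y|) := by
  have hp := deriv_mul_deriv_pos hJ hx hy
  have hy0 : deriv S.T y ≠ 0 := ((S.hdiffeo J hJ).2.1 y hy).2
  have hq : 0 < deriv S.T x / deriv S.T y := by
    rw [div_eq_mul_inv, ← mul_pos_iff_of_pos_right (sq_pos_of_ne_zero hy0)]
    field_simp
    exact hp
  have h := S.hdist J hJ x hx y hy
  rw [← abs_of_pos hq, abs_div, div_le_iff₀ (abs_pos.2 hy0)] at h
  linarith

lemma J_subset : S.J ⊆ Ioo 0 1 := by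
  rintro x ⟨J, hJ, hx⟩
  exact (S.hN J hJ).2.2.2 hx

lemma mapsTo_T {x : ℝ} (hx : x ∈ S.J) : S.T x ∈ Icc (0 : ℝ) 1 := by
  obtain ⟨J, hJ, hxJ⟩ := hx
  exact (S.hdiffeo J hJ).1.mapsTo hxJ

/-! ### Orbits staying in the domain -/

lemma Stays.mono {m n : ℕ} (hmn : m ≤ n) {x : ℝ} (h : S.Stays n x) : S.Stays m x :=
  fun k hk => h k (hk.trans_le hmn)

lemma Stays.iterate {m n : ℕ} {x : ℝ} (h : S.Stays (m + n) x) : S.Stays n (S.T^[m] x) := by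
  intro k hk
  rw [← Function.iterate_add_apply]
  exact h _ (by omega)

lemma stays_succ {n : ℕ} {x : ℝ} : S.Stays (n + 1) x ↔ x ∈ S.J ∧ S.Stays n (S.T x) := by
  constructor
  · refine fun h => ⟨h 0 (by omega), fun k hk => ?_⟩
    rw [← Function.iterate_succ_apply]
    exact h _ (by omega)
  · rintro ⟨h0, h⟩ k hk
    rcases k with _ | k
    · exact h0
    · rw [Function.iterate_succ_apply]
      exact h k (by omega)

lemma derIter_add (T : ℝ → ℝ) (m n : ℕ) (x : ℝ) :
    derIter T (m + n) x = derIter T m x * derIter T n (T^[m] x) := by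
  unfold derIter
  rw [Finset.prod_range_add]
  congr 1
  refine Finset.prod_congr rfl fun k _ => ?_
  rw [← Function.iterate_add_apply, add_comm]

lemma derIter_succ (T : ℝ → ℝ) (n : ℕ) (x : ℝ) :
    derIter T (n + 1) x = derIter T n x * deriv T (T^[n] x) :=
  Finset.prod_range_succ _ _

lemma Stays.hasDerivAt {n : ℕ} {x : ℝ} (h : S.Stays n x) :
    HasDerivAt (S.T^[n]) (derIter S.T n x) x := by
  induction n with
  | zero => simpa [derIter] using hasDerivAt_id x
  | succ n ih =>
    obtain ⟨J, hJ, hxJ⟩ := h n (by omega)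
    have h1 := ((S.hdiffeo J hJ).2.1 _ hxJ).1.hasDerivAt
    have h2 := h1.comp x (ih (h.mono (by omega)))
    rw [Function.iterate_succ', derIter_succ, mul_comm]
    exact h2

lemma Stays.derIter_ne_zero {n : ℕ} {x : ℝ} (h : S.Stays n x) : derIter S.T n x ≠ 0 := by
  refine Finset.prod_ne_zero_iff.2 fun k hk => ?_
  obtain ⟨J, hJ, hxJ⟩ := h k (Finset.mem_range.1 hk)
  exact ((S.hdiffeo J hJ).2.1 _ hxJ).2

lemma Stays.exists_abs_sub_eq {n : ℕ} {A : Set ℝ} (hA : A.OrdConnected)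
    (hst : ∀ z ∈ A, S.Stays n z) {y z : ℝ} (hy : y ∈ A) (hz : z ∈ A) :
    ∃ ξ ∈ A, |S.T^[n] y - S.T^[n] z| = |derIter S.T n ξ| * |y - z| := by
  wlog hyz : y ≤ z generalizing y z
  · obtain ⟨ξ, hξ, h⟩ := this hz hy (le_of_not_ge hyz)
    exact ⟨ξ, hξ, by rw [abs_sub_comm, h, abs_sub_comm z y]⟩
  rcases hyz.eq_or_lt with rfl | hlt
  · exact ⟨y, hy, by simp⟩
  have hsub : Icc y z ⊆ A := hA.out hy hz
  obtain ⟨ξ, hξ, h⟩ := exists_hasDerivAt_eq_slope (S.T^[n]) (derIter S.T n) hlt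
    (fun w hw => (hst w (hsub hw)).hasDerivAt.continuousAt.continuousWithinAt)
    (fun w hw => (hst w (hsub (Ioo_subset_Icc_self hw))).hasDerivAt)
  refine ⟨ξ, hsub (Ioo_subset_Icc_self hξ), ?_⟩
  have hne : z - y ≠ 0 := by linarith
  rw [h, abs_div, abs_sub_comm y z, div_mul_cancel₀ _ (abs_ne_zero.2 hne), abs_sub_comm]

/-! ### Pullbacks and cylinders -/

lemma stays_of_mem_pull {n : ℕ} {x z : ℝ} {C : Set ℝ} (hz : z ∈ S.pull n x C) : S.Stays n z := by
  intro k hk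
  obtain ⟨J, hJ, -, h⟩ := hz.1 k hk
  exact ⟨J, hJ, h⟩

lemma pull_mono {n : ℕ} {x : ℝ} {C C' : Set ℝ} (h : C ⊆ C') : S.pull n x C ⊆ S.pull n x C' :=
  fun _ hz => ⟨hz.1, h hz.2⟩

@[simp] lemma pull_zero (x : ℝ) (C : Set ℝ) : S.pull 0 x C = C := by
  ext z; simp [pull]

lemma pull_add (m n : ℕ) (x : ℝ) (C : Set ℝ) :
    S.pull (m + n) x C = S.pull m x (S.pull n (S.T^[m] x) C) := by
  ext z
  constructor
  · rintro ⟨h, hC⟩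
    refine ⟨fun k hk => h k (by omega), fun k hk => ?_, ?_⟩
    · rw [← Function.iterate_add_apply, ← Function.iterate_add_apply]
      exact h _ (by omega)
    · rw [← Function.iterate_add_apply, add_comm]
      exact hC
  · rintro ⟨h, h', hC⟩
    refine ⟨fun k hk => ?_, ?_⟩
    · rcases lt_or_ge k m with hkm | hkm
      · exact h k hkm
      · have := h' (k - m) (by omega)
        rwa [← Function.iterate_add_apply, ← Function.iterate_add_apply,
          Nat.sub_add_cancel hkm] at this
    · rw [← Function.iterate_add_apply, add_comm] at hC
      exact hC

lemma pull_one {J : Set ℝ} (hJ : J ∈ S.Nfam) {x : ℝ} (hx : x ∈ J) (C : Set ℝ) :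
    S.pull 1 x C = J ∩ S.T ⁻¹' C := by
  ext z
  constructor
  · rintro ⟨h, hC⟩
    obtain ⟨J', hJ', hx', hz'⟩ := h 0 (by omega)
    obtain rfl := eq_of_mem hJ hJ' hx hx'
    exact ⟨hz', hC⟩
  · rintro ⟨hz, hC⟩
    refine ⟨fun k hk => ?_, hC⟩
    obtain rfl : k = 0 := by omega
    exact ⟨J, hJ, hx, hz⟩

lemma pull_succ {J : Set ℝ} (hJ : J ∈ S.Nfam) {x : ℝ} (hx : x ∈ J) (n : ℕ) (C : Set ℝ) :
    S.pull (n + 1) x C = J ∩ S.T ⁻¹' (S.pull n (S.T x) C) := by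
  rw [add_comm, pull_add, pull_one hJ hx]
  rfl

lemma ordConnected_pull {n : ℕ} {x : ℝ} (hx : S.Stays n x) {C : Set ℝ} (hC : C.OrdConnected) :
    (S.pull n x C).OrdConnected := by
  induction n generalizing x with
  | zero => simpa using hC
  | succ n ih =>
    obtain ⟨⟨J, hJ, hxJ⟩, h⟩ := stays_succ.1 hx
    rw [pull_succ hJ hxJ]
    exact ordConnected_inter_preimage hJ (ih h)

lemma isClosed_pull {n : ℕ} {x : ℝ} (hx : S.Stays n x) {C : Set ℝ} (hC : IsClosed C) :
    IsClosed (S.pull n x C) := by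
  induction n generalizing x with
  | zero => simpa using hC
  | succ n ih =>
    obtain ⟨⟨J, hJ, hxJ⟩, h⟩ := stays_succ.1 hx
    rw [pull_succ hJ hxJ]
    exact (continuousOn_T hJ).preimage_isClosed_of_isClosed (S.hN J hJ).1.isClosed (ih h)

lemma exists_mem_pull {n : ℕ} {x : ℝ} (hx : S.Stays n x) {C : Set ℝ} {t : ℝ} (ht : t ∈ C)
    (ht' : t ∈ Icc (0 : ℝ) 1) : ∃ z ∈ S.pull n x C, S.T^[n] z = t := by
  suffices h : ∃ z ∈ Icc (0 : ℝ) 1, z ∈ S.pull n x C ∧ S.T^[n] z = t by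
    obtain ⟨z, -, h⟩ := h
    exact ⟨z, h⟩
  induction n generalizing x with
  | zero => exact ⟨t, ht', by simpa using ht⟩
  | succ n ih =>
    obtain ⟨⟨J, hJ, hxJ⟩, h⟩ := stays_succ.1 hx
    obtain ⟨w, hw, hwp, hwt⟩ := ih h
    obtain ⟨z, hz, rfl⟩ := (S.hdiffeo J hJ).1.surjOn hw
    rw [pull_succ hJ hxJ]
    exact ⟨z, Ioo_subset_Icc_self ((S.hN J hJ).2.2.2 hz), ⟨hz, hwp⟩, hwt⟩

lemma injOn_pull {n : ℕ} {x : ℝ} (hx : S.Stays n x) {C : Set ℝ} :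
    InjOn (S.T^[n]) (S.pull n x C) := by
  induction n generalizing x with
  | zero => simp
  | succ n ih =>
    obtain ⟨⟨J, hJ, hxJ⟩, h⟩ := stays_succ.1 hx
    rw [pull_succ hJ hxJ]
    intro y hy z hz hyz
    exact (S.hdiffeo J hJ).1.injOn hy.1 hz.1 (ih h hy.2 hz.2 hyz)

lemma cyl_add (m n : ℕ) (x : ℝ) : S.cyl (m + n) x = S.pull m x (S.cyl n (S.T^[m] x)) :=
  pull_add ..

lemma pull_subset_Icc {n : ℕ} {x : ℝ} {C : Set ℝ} (hC : C ⊆ Icc 0 1) :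
    S.pull n x C ⊆ Icc 0 1 := by
  rcases n with _ | n
  · simpa using hC
  · intro z hz
    exact Ioo_subset_Icc_self (J_subset (stays_of_mem_pull hz 0 (by omega)))

lemma cyl_subset_Icc (n : ℕ) (x : ℝ) : S.cyl n x ⊆ Icc 0 1 := pull_subset_Icc subset_rfl

lemma cyl_anti {m n : ℕ} (h : m ≤ n) (x : ℝ) : S.cyl n x ⊆ S.cyl m x := by
  obtain ⟨k, rfl⟩ := Nat.exists_eq_add_of_le h
  rw [cyl_add]
  exact pull_mono (cyl_subset_Icc _ _)

lemma Stays.iterate_mem_Icc {n : ℕ} {x : ℝ} (hx : S.Stays n x) (h : x ∈ Icc (0 : ℝ) 1) :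
    S.T^[n] x ∈ Icc (0 : ℝ) 1 := by
  rcases n with _ | n
  · exact h
  · rw [Function.iterate_succ_apply']
    exact mapsTo_T (hx n (by omega))

lemma self_mem_pull {n : ℕ} {x : ℝ} (hx : S.Stays n x) {C : Set ℝ} (h : S.T^[n] x ∈ C) :
    x ∈ S.pull n x C := by
  refine ⟨fun k hk => ?_, h⟩
  obtain ⟨J, hJ, hxJ⟩ := hx k hk
  exact ⟨J, hJ, hxJ, hxJ⟩

lemma self_mem_cyl {n : ℕ} {x : ℝ} (hx : S.Stays n x) (h : x ∈ Icc (0 : ℝ) 1) : x ∈ S.cyl n x :=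
  self_mem_pull hx (hx.iterate_mem_Icc h)

lemma pull_eq_of_mem {n : ℕ} {x y : ℝ} {C C' : Set ℝ} (h : y ∈ S.pull n x C) :
    S.pull n y C' = S.pull n x C' := by
  ext z
  refine and_congr_left fun _ => forall₂_congr fun k hk => ?_
  obtain ⟨J, hJ, hxJ, hyJ⟩ := h.1 k hk
  constructor
  · rintro ⟨J', hJ', hy', hz'⟩
    obtain rfl := eq_of_mem hJ hJ' hyJ hy'
    exact ⟨J, hJ, hxJ, hz'⟩
  · rintro ⟨J', hJ', hy', hz'⟩
    obtain rfl := eq_of_mem hJ hJ' hxJ hy'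
    exact ⟨J, hJ, hyJ, hz'⟩

lemma cyl_eq_of_mem {n : ℕ} {x y : ℝ} (h : y ∈ S.cyl n x) : S.cyl n y = S.cyl n x :=
  pull_eq_of_mem h

lemma iterate_mem_cyl {m n : ℕ} {x y : ℝ} (h : y ∈ S.cyl (m + n) x) :
    S.T^[m] y ∈ S.cyl n (S.T^[m] x) := by
  rw [cyl_add] at h
  exact h.2

lemma ordConnected_cyl {n : ℕ} {x : ℝ} (hx : S.Stays n x) : (S.cyl n x).OrdConnected :=
  ordConnected_pull hx ordConnected_Icc

lemma isClosed_cyl {n : ℕ} {x : ℝ} (hx : S.Stays n x) : IsClosed (S.cyl n x) :=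
  isClosed_pull hx isClosed_Icc

lemma lenSum_eq_of_mem {n : ℕ} {x y : ℝ} (h : y ∈ S.cyl n x) : S.lenSum n y = S.lenSum n x := by
  refine Finset.sum_congr rfl fun i hi => ?_
  have hi' := Finset.mem_range.1 hi
  rw [cyl_eq_of_mem (x := S.T^[i + 1] x)]
  exact iterate_mem_cyl (by rwa [show i + 1 + (n - 1 - i) = n by omega])

/-! ### Lengths -/

lemma abs_sub_le_len {A : Set ℝ} (hA : A.OrdConnected) (hfin : volume A ≠ ⊤) {y z : ℝ}
    (hy : y ∈ A) (hz : z ∈ A) : |y - z| ≤ volume.real A := by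
  have h := measureReal_mono (μ := volume) (hA.uIcc_subset hz hy) hfin
  rwa [measureReal_def, Real.volume_interval, ENNReal.toReal_ofReal (abs_nonneg _)] at h

lemma len_le_of_abs_sub_le {A : Set ℝ} {d : ℝ} (hd : 0 ≤ d)
    (h : ∀ y ∈ A, ∀ z ∈ A, |y - z| ≤ d) : volume.real A ≤ d := by
  refine ENNReal.toReal_le_of_le_ofReal hd ((Real.volume_le_diam A).trans ?_)
  refine Metric.ediam_le fun y hy z hz => ?_
  rw [edist_dist, Real.dist_eq]
  exact ENNReal.ofReal_le_ofReal (h y hy z hz)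

lemma volume_ne_top_of_subset_Icc {A : Set ℝ} (hA : A ⊆ Icc 0 1) : volume A ≠ ⊤ :=
  ((measure_mono hA).trans_lt (by simp)).ne

lemma len_le_one_of_subset_Icc {A : Set ℝ} (hA : A ⊆ Icc 0 1) : volume.real A ≤ 1 := by
  simpa using measureReal_mono (μ := volume) hA (by simp)

lemma sum_len_le_one {ι : Type*} (s : Finset ι) (A : ι → Set ℝ) (hm : ∀ i ∈ s, MeasurableSet (A i))
    (hA : ∀ i ∈ s, A i ⊆ Icc 0 1) (hd : (s : Set ι).PairwiseDisjoint A) :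
    ∑ i ∈ s, volume.real (A i) ≤ 1 := by
  rw [← measureReal_biUnion_finset hd hm fun i hi => volume_ne_top_of_subset_Icc (hA i hi)]
  exact len_le_one_of_subset_Icc (Set.iUnion₂_subset hA)

lemma len_le_div {n : ℕ} {A B : Set ℝ} (hA : A.OrdConnected) (hst : ∀ z ∈ A, S.Stays n z)
    (hB : B.OrdConnected) (hfin : volume B ≠ ⊤) (hmaps : ∀ z ∈ A, S.T^[n] z ∈ B) {μ : ℝ}
    (hμ : 0 < μ) (hder : ∀ z ∈ A, μ ≤ |derIter S.T n z|) :
    volume.real A ≤ volume.real B / μ := by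
  refine len_le_of_abs_sub_le (by positivity) fun y hy z hz => ?_
  obtain ⟨ξ, hξ, h⟩ := Stays.exists_abs_sub_eq hA hst hy hz
  rw [le_div_iff₀ hμ]
  calc |y - z| * μ ≤ |y - z| * |derIter S.T n ξ| := by gcongr; exact hder ξ hξ
    _ = |S.T^[n] y - S.T^[n] z| := by rw [h, mul_comm]
    _ ≤ _ := abs_sub_le_len hB hfin (hmaps y hy) (hmaps z hz)

/-! ### Distortion -/

lemma abs_derIter_le {n : ℕ} {x y z : ℝ} {C : Set ℝ} (hy : y ∈ S.pull n x C)
    (hz : z ∈ S.pull n x C) :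
    |derIter S.T n y| ≤ |derIter S.T n z| *
      Real.exp (S.Dd * ∑ i ∈ Finset.range n, |S.T^[i + 1] y - S.T^[i + 1] z|) := by
  rw [Finset.mul_sum, Real.exp_sum]
  unfold derIter
  rw [Finset.abs_prod, Finset.abs_prod, ← Finset.prod_mul_distrib]
  refine Finset.prod_le_prod (fun _ _ => abs_nonneg _) fun k hk => ?_
  obtain ⟨J, hJ, hxJ, hyJ⟩ := hy.1 k (Finset.mem_range.1 hk)
  obtain ⟨J', hJ', hxJ', hzJ⟩ := hz.1 k (Finset.mem_range.1 hk)
  obtain rfl := eq_of_mem hJ hJ' hxJ hxJ'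
  refine (abs_deriv_le hJ hyJ hzJ).trans ?_
  gcongr
  rw [Function.iterate_succ_apply', Function.iterate_succ_apply', add_comm]
  exact Real.add_one_le_exp _

lemma abs_derIter_le_of_sum_le {n : ℕ} {x y z M : ℝ} {C : Set ℝ} (hy : y ∈ S.pull n x C)
    (hz : z ∈ S.pull n x C)
    (hM : ∑ i ∈ Finset.range n, |S.T^[i + 1] y - S.T^[i + 1] z| ≤ M) :
    |derIter S.T n y| ≤ |derIter S.T n z| * Real.exp (S.Dd * M) := by
  refine (abs_derIter_le hy hz).trans ?_
  have := S.hDd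
  gcongr

lemma abs_sub_iterate_le {n i : ℕ} (hi : i < n) {x y z : ℝ} (hx : S.Stays n x) {C : Set ℝ}
    (hC : C.OrdConnected) (hC' : C ⊆ Icc 0 1) (hy : y ∈ S.pull n x C) (hz : z ∈ S.pull n x C) :
    |S.T^[i + 1] y - S.T^[i + 1] z| ≤ volume.real (S.pull (n - 1 - i) (S.T^[i + 1] x) C) := by
  have hn : n = i + 1 + (n - 1 - i) := by omega
  rw [hn, pull_add] at hy hz
  rw [hn] at hx
  exact abs_sub_le_len (ordConnected_pull hx.iterate hC)
    (volume_ne_top_of_subset_Icc (pull_subset_Icc hC')) hy.2 hz.2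

lemma abs_derIter_le_of_lenSum_le {n : ℕ} {x y z M : ℝ} (hx : S.Stays n x) (hy : y ∈ S.cyl n x)
    (hz : z ∈ S.cyl n x) (hM : S.lenSum n x ≤ M) :
    |derIter S.T n y| ≤ |derIter S.T n z| * Real.exp (S.Dd * M) :=
  abs_derIter_le_of_sum_le hy hz <| (Finset.sum_le_sum fun _ hi =>
    abs_sub_iterate_le (Finset.mem_range.1 hi) hx ordConnected_Icc subset_rfl hy hz).trans hM

lemma one_le_abs_derIter_mul {n : ℕ} {x M : ℝ} (hx : S.Stays n x) (hx' : x ∈ Icc (0 : ℝ) 1)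
    (hM : S.lenSum n x ≤ M) :
    1 ≤ |derIter S.T n x| * (Real.exp (S.Dd * M) * volume.real (S.cyl n x)) := by
  obtain ⟨y, hy, hy0⟩ := exists_mem_pull hx (C := Icc 0 1) (t := 0) (by simp) (by simp)
  obtain ⟨z, hz, hz1⟩ := exists_mem_pull hx (C := Icc 0 1) (t := 1) (by simp) (by simp)
  obtain ⟨ξ, hξ, h⟩ := Stays.exists_abs_sub_eq (ordConnected_cyl hx)
    (fun w hw => stays_of_mem_pull hw) hy hz
  rw [hy0, hz1] at h
  have h1 := abs_derIter_le_of_lenSum_le hx hξ (self_mem_cyl hx hx') hM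
  have h2 := abs_sub_le_len (ordConnected_cyl hx)
    (volume_ne_top_of_subset_Icc (cyl_subset_Icc n x)) hy hz
  calc (1 : ℝ) = |derIter S.T n ξ| * |y - z| := by rw [← h]; norm_num
    _ ≤ (|derIter S.T n x| * Real.exp (S.Dd * M)) * volume.real (S.cyl n x) := by gcongr
    _ = _ := by ring

lemma inv_le_abs_deriv {x : ℝ} (hx : x ∈ S.J) : (1 + S.Dd)⁻¹ ≤ |deriv S.T x| := by
  have hst : S.Stays 1 x := fun k hk => by
    obtain rfl : k = 0 := by omega
    exact hx
  obtain ⟨J, hJ, hxJ⟩ := id hx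
  obtain ⟨y, hy, hy0⟩ := exists_mem_pull hst (C := Icc 0 1) (t := 0) (by simp) (by simp)
  obtain ⟨z, hz, hz1⟩ := exists_mem_pull hst (C := Icc 0 1) (t := 1) (by simp) (by simp)
  obtain ⟨ξ, hξ, h⟩ := Stays.exists_abs_sub_eq (ordConnected_cyl hst)
    (fun w hw => stays_of_mem_pull hw) hy hz
  rw [hy0, hz1] at h
  have hle : |y - z| ≤ 1 := by
    have h1 := cyl_subset_Icc 1 x hy
    have h2 := cyl_subset_Icc 1 x hz
    rw [abs_le]; constructor <;> linarith [h1.1, h1.2, h2.1, h2.2]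
  have hder : derIter S.T 1 ξ = deriv S.T ξ := by simp [derIter]
  rw [hder] at h
  rw [cyl, pull_one hJ hxJ] at hξ
  have h1 := abs_deriv_le hJ hξ.1 hxJ
  have hT : |S.T ξ - S.T x| ≤ 1 := by
    have h1 := hξ.2
    have h2 := mapsTo_T hx
    rw [abs_le]; constructor <;> linarith [h1.1, h1.2, h2.1, h2.2]
  have hD := S.hDd
  rw [inv_le_iff_one_le_mul₀ (by positivity)]
  calc (1 : ℝ) = |deriv S.T ξ| * |y - z| := by rw [← h]; norm_num
    _ ≤ |deriv S.T ξ| * 1 := by gcongr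
    _ ≤ |deriv S.T x| * (1 + S.Dd * |S.T ξ - S.T x|) := by simpa using h1
    _ ≤ |deriv S.T x| * (1 + S.Dd * 1) := by gcongr
    _ = _ := by ring

lemma Stays.inv_pow_le_abs_derIter {n : ℕ} {x : ℝ} (hx : S.Stays n x) :
    ((1 + S.Dd)⁻¹) ^ n ≤ |derIter S.T n x| := by
  have hD := S.hDd
  unfold derIter
  rw [Finset.abs_prod]
  calc ((1 + S.Dd)⁻¹) ^ n = ∏ k ∈ Finset.range n, (1 + S.Dd)⁻¹ := by simp
    _ ≤ _ := Finset.prod_le_prod (fun _ _ => by positivity)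
      fun k hk => inv_le_abs_deriv (hx k (Finset.mem_range.1 hk))

/-! ### First occurrences -/

lemma disjoint_cyl_of_first {x : ℝ} {j L : ℕ} (hx : S.Stays (j + L) x) (hx' : x ∈ Icc (0 : ℝ) 1)
    (hfirst : ∀ i < j, S.T^[j] x ∉ S.cyl L (S.T^[i] x)) {i i' : ℕ} (hi : i < i') (hi' : i' ≤ j) :
    Disjoint (S.cyl (j + L - i) (S.T^[i] x)) (S.cyl (j + L - i') (S.T^[i'] x)) := by
  rw [Set.disjoint_left]
  intro y hy hy'
  have h1 : S.T^[j - i'] y ∈ S.cyl L (S.T^[i + (j - i')] x) := by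
    have := iterate_mem_cyl (m := j - i') (n := L)
      (cyl_anti (show j - i' + L ≤ j + L - i by omega) _ hy)
    rwa [← Function.iterate_add_apply, add_comm (j - i')] at this
  have h2 : S.T^[j - i'] y ∈ S.cyl L (S.T^[j] x) := by
    have := iterate_mem_cyl (m := j - i') (n := L)
      (cyl_anti (show j - i' + L ≤ j + L - i' by omega) _ hy')
    rwa [← Function.iterate_add_apply, Nat.sub_add_cancel hi'] at this
  refine hfirst (i + (j - i')) (by omega) ?_
  rw [← cyl_eq_of_mem h1, cyl_eq_of_mem h2]
  exact self_mem_cyl hx.iterate ((hx.mono (by omega)).iterate_mem_Icc hx')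

lemma lenSum_add (m n : ℕ) (x : ℝ) :
    S.lenSum (m + n) x =
      ∑ i ∈ Finset.range m, volume.real (S.cyl (m + n - (i + 1)) (S.T^[i + 1] x)) +
        S.lenSum n (S.T^[m] x) := by
  unfold lenSum
  rw [Finset.sum_range_add]
  congr 1
  · refine Finset.sum_congr rfl fun i _ => ?_
    congr 2
    omega
  · refine Finset.sum_congr rfl fun i _ => ?_
    rw [← Function.iterate_add_apply]
    congr 2
    · omega
    · congr 1
      omega

lemma lenSum_le_of_first {x : ℝ} {j L : ℕ} (hx : S.Stays (j + L) x) (hx' : x ∈ Icc (0 : ℝ) 1)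
    (hfirst : ∀ i < j, S.T^[j] x ∉ S.cyl L (S.T^[i] x)) :
    S.lenSum (j + L) x ≤ 1 + S.lenSum L (S.T^[j] x) := by
  rw [lenSum_add]
  gcongr
  refine sum_len_le_one _ _ (fun i hi => ?_) (fun i _ => cyl_subset_Icc _ _) ?_
  · have hi' := Finset.mem_range.1 hi
    refine (ordConnected_cyl (Stays.iterate ?_)).measurableSet
    rwa [show i + 1 + (j + L - (i + 1)) = j + L by omega]
  · intro i hi i' hi' hne
    have h1 := Finset.mem_range.1 hi
    have h2 := Finset.mem_range.1 hi'
    rcases lt_or_gt_of_ne hne with h | h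
    · exact disjoint_cyl_of_first hx hx' hfirst (by omega) (by omega)
    · exact (disjoint_cyl_of_first hx hx' hfirst (by omega) (by omega)).symm

lemma lenSum_le_self (n : ℕ) (x : ℝ) : S.lenSum n x ≤ n := by
  calc S.lenSum n x ≤ ∑ i ∈ Finset.range n, (1 : ℝ) :=
        Finset.sum_le_sum fun i _ => len_le_one_of_subset_Icc (cyl_subset_Icc _ _)
    _ = n := by simp

/-! ### Pulling back slightly enlarged intervals -/

lemma len_pull_le_two_mul {C E : Set ℝ} (hC : C.OrdConnected) (hE : E.OrdConnected) (hCE : C ⊆ E)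
    (hE' : E ⊆ Icc 0 1) {c d : ℝ} (hc : c ∈ C) (hd : d ∈ C) (hcd : c ≠ d)
    (hdiff : ∀ s ∈ E \ C, ∀ t ∈ E \ C, |s - t| ≤ Real.exp (-(S.Dd * 4)) * |c - d|)
    {n : ℕ} {x : ℝ} (hx : S.Stays n x)
    (hsum : ∑ i ∈ Finset.range (n + 1), volume.real (S.pull (n - i) (S.T^[i] x) C) ≤ 2) :
    volume.real (S.pull n x E) ≤ 2 * volume.real (S.pull n x C) ∧
      ∀ y ∈ S.pull n x E, ∀ z ∈ S.pull n x E,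
        |derIter S.T n y| ≤ |derIter S.T n z| * Real.exp (S.Dd * 4) := by
  induction n using Nat.strong_induction_on generalizing x with
  | _ n ih =>
  have hdist : ∀ y ∈ S.pull n x E, ∀ z ∈ S.pull n x E,
      |derIter S.T n y| ≤ |derIter S.T n z| * Real.exp (S.Dd * 4) := by
    intro y hy z hz
    refine abs_derIter_le_of_sum_le hy hz ?_
    calc ∑ i ∈ Finset.range n, |S.T^[i + 1] y - S.T^[i + 1] z|
        ≤ ∑ i ∈ Finset.range n, 2 * volume.real (S.pull (n - (i + 1)) (S.T^[i + 1] x) C) := by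
          refine Finset.sum_le_sum fun i hi => ?_
          have hi' := Finset.mem_range.1 hi
          have h1 := abs_sub_iterate_le hi' hx hE hE' hy hz
          rw [show n - 1 - i = n - (i + 1) by omega] at h1
          refine h1.trans (ih (n - (i + 1)) (by omega) ?_ ?_).1
          · refine Stays.iterate ?_
            rwa [show i + 1 + (n - (i + 1)) = n by omega]
          · refine le_trans ?_ hsum
            rw [show n + 1 = i + 1 + (n - (i + 1) + 1) by omega, Finset.sum_range_add _ (i + 1)]
            refine le_add_of_nonneg_of_le (Finset.sum_nonneg fun _ _ => measureReal_nonneg) ?_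
            refine Finset.sum_le_sum fun k _ => le_of_eq ?_
            rw [← Function.iterate_add_apply, add_comm k]
            congr 2
            omega
      _ = 2 * ∑ i ∈ Finset.range n, volume.real (S.pull (n - (i + 1)) (S.T^[i + 1] x) C) := by
          rw [Finset.mul_sum]
      _ ≤ 2 * 2 := by
          rw [Finset.sum_range_succ'] at hsum
          have : 0 ≤ volume.real (S.pull (n - 0) (S.T^[0] x) C) := measureReal_nonneg
          gcongr
          linarith
      _ = 4 := by norm_num
  refine ⟨?_, hdist⟩
  have hC' := hCE.trans hE'
  have hfin : volume (S.pull n x C) ≠ ⊤ := volume_ne_top_of_subset_Icc (pull_subset_Icc hC')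
  obtain ⟨u, hu, rfl⟩ := exists_mem_pull hx hc (hC' hc)
  obtain ⟨v, hv, rfl⟩ := exists_mem_pull hx hd (hC' hd)
  obtain ⟨ξ, hξ, h⟩ := Stays.exists_abs_sub_eq (ordConnected_pull hx hC)
    (fun w hw => stays_of_mem_pull hw) hu hv
  have huv := abs_sub_le_len (ordConnected_pull hx hC) hfin hu hv
  have hsmall : volume.real (S.pull n x E \ S.pull n x C) ≤ volume.real (S.pull n x C) := by
    refine len_le_of_abs_sub_le measureReal_nonneg fun y hy z hz => ?_
    obtain ⟨ζ, hζ, h'⟩ := Stays.exists_abs_sub_eq (ordConnected_pull hx hE)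
      (fun w hw => stays_of_mem_pull hw) hy.1 hz.1
    have h1 := hdiff (S.T^[n] y) ⟨hy.1.2, fun hh => hy.2 ⟨hy.1.1, hh⟩⟩ (S.T^[n] z)
      ⟨hz.1.2, fun hh => hz.2 ⟨hz.1.1, hh⟩⟩
    have h2 := hdist ξ (pull_mono hCE hξ) ζ hζ
    have h3 : 0 < |derIter S.T n ζ| := abs_pos.2 (stays_of_mem_pull hζ).derIter_ne_zero
    refine le_of_mul_le_mul_left ?_ h3
    calc |derIter S.T n ζ| * |y - z| ≤ Real.exp (-(S.Dd * 4)) * |S.T^[n] u - S.T^[n] v| := by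
          rw [← h']; exact h1
      _ = Real.exp (-(S.Dd * 4)) * (|derIter S.T n ξ| * |u - v|) := by rw [h]
      _ ≤ Real.exp (-(S.Dd * 4)) * ((|derIter S.T n ζ| * Real.exp (S.Dd * 4)) *
            volume.real (S.pull n x C)) := by gcongr
      _ = _ := by
          rw [Real.exp_neg]
          field_simp
  calc volume.real (S.pull n x E)
      ≤ volume.real (S.pull n x C ∪ (S.pull n x E \ S.pull n x C)) := by
        refine measureReal_mono (by rw [union_sdiff_self]; exact subset_union_right) ?_
        refine volume_ne_top_of_subset_Icc (union_subset (pull_subset_Icc hC') ?_)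
        exact sdiff_subset.trans (pull_subset_Icc hE')
    _ ≤ volume.real (S.pull n x C) + volume.real (S.pull n x E \ S.pull n x C) :=
        measureReal_union_le _ _
    _ ≤ _ := by linarith

/-! ### Periodic orbits -/

lemma derIter_mul_of_periodic (T : ℝ → ℝ) {p : ℕ} {x : ℝ} (hp : T^[p] x = x) (m : ℕ) :
    derIter T (p * m) x = derIter T p x ^ m := by
  induction m with
  | zero => simp [derIter]
  | succ m ih => rw [Nat.mul_succ, add_comm, derIter_add, hp, ih, pow_succ']

lemma one_lt_abs_derIter_of_periodic {q : ℕ} (hq : 1 ≤ q) {x : ℝ} (hx : S.Stays q x)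
    (hper : S.T^[q] x = x) : 1 < |derIter S.T q x| := by
  have hP : Function.IsPeriodicPt S.T q x := hper
  have hpos : 0 < Function.minimalPeriod S.T x := hP.minimalPeriod_pos hq
  obtain ⟨m, hm⟩ := hP.minimalPeriod_dvd
  have hle : Function.minimalPeriod S.T x ≤ q := hP.minimalPeriod_le hq
  have h1 := S.hper x (Function.minimalPeriod S.T x) hpos (hx.mono hle)
    (Function.isPeriodicPt_minimalPeriod S.T x)
    fun k hk hk' h => Function.not_isPeriodicPt_of_pos_of_lt_minimalPeriod hk.ne' hk' h
  have hm0 : m ≠ 0 := by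
    rintro rfl
    omega
  rw [hm, derIter_mul_of_periodic _ (Function.isPeriodicPt_minimalPeriod S.T x), abs_pow]
  exact one_lt_pow₀ h1 hm0

lemma exists_fixed_deriv_le_one {g g' : ℝ → ℝ} {a b : ℝ} (hab : a < b)
    (hg : ∀ x ∈ Icc a b, HasDerivAt g (g' x) x) (ha : g a = a) (hb : g b = b) :
    ∃ x ∈ Icc a b, g x = x ∧ g' x ≤ 1 := by
  by_contra! hrep
  set h : ℝ → ℝ := fun x => g x - x with hh
  have hder : ∀ x ∈ Icc a b, HasDerivAt h (g' x - 1) x := fun x hx =>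
    (hg x hx).sub (hasDerivAt_id x)
  have hsign : ∀ x ∈ Icc a b, h x = 0 →
      ∀ᶠ y in nhds x, SignType.sign (h y) = SignType.sign (y - x) := by
    intro x hx h0
    refine eventually_nhdsWithin_sign_eq_of_deriv_pos ?_ h0
    rw [(hder x hx).deriv]
    linarith [hrep x hx (by simpa [hh, sub_eq_zero] using h0)]
  obtain ⟨b', hb'neg, hb'⟩ : ∃ b', h b' < 0 ∧ b' ∈ Ioo a b := by
    have h1 := (hsign b ⟨hab.le, le_rfl⟩ (by simp [hh, hb])).filter_mono
      (nhdsWithin_le_nhds (s := Iio b))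
    obtain ⟨y, hy, hy'⟩ := (h1.and (Ioo_mem_nhdsLT hab)).exists
    refine ⟨y, ?_, hy'⟩
    rw [← sign_eq_neg_one_iff, hy, sign_eq_neg_one_iff]
    linarith [hy'.2]
  have hcont : ContinuousOn h (Icc a b') := fun x hx =>
    (hder x ⟨hx.1, hx.2.trans hb'.2.le⟩).continuousAt.continuousWithinAt
  have hcomp : IsCompact (Icc a b' ∩ h ⁻¹' Ici 0) :=
    isCompact_Icc.of_isClosed_subset
      (hcont.preimage_isClosed_of_isClosed isClosed_Icc isClosed_Ici) inter_subset_left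
  obtain ⟨s, ⟨hs, hs0⟩, hmax⟩ := hcomp.exists_isGreatest
    ⟨a, ⟨le_rfl, hb'.1.le⟩, by simp [hh, ha]⟩
  have hs0' : 0 ≤ h s := hs0
  have hsb : s < b' := lt_of_le_of_ne hs.2 (by rintro rfl; linarith)
  have hzero : h s = 0 := by
    obtain ⟨t, ht, ht0⟩ := intermediate_value_Icc' hsb.le
      (hcont.mono (Icc_subset_Icc_left hs.1)) ⟨hb'neg.le, hs0'⟩
    have : t ≤ s := hmax ⟨⟨hs.1.trans ht.1, ht.2⟩, ht0.ge⟩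
    rwa [le_antisymm this ht.1] at ht0
  have h1 := (hsign s ⟨hs.1, hs.2.trans hb'.2.le⟩ hzero).filter_mono
    (nhdsWithin_le_nhds (s := Ioi s))
  obtain ⟨y, hy, hy'⟩ := (h1.and (Ioo_mem_nhdsGT hsb)).exists
  have hpos : 0 < h y := by
    rw [← sign_eq_one_iff, hy, sign_eq_one_iff]
    linarith [hy'.1]
  have : y ≤ s := hmax ⟨⟨hs.1.trans hy'.1.le, hy'.2.le⟩, hpos.le⟩
  linarith [hy'.1]

lemma derIter_mul_derIter_pos {n : ℕ} {x y z : ℝ} {C : Set ℝ} (hy : y ∈ S.pull n x C)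
    (hz : z ∈ S.pull n x C) : 0 < derIter S.T n y * derIter S.T n z := by
  unfold derIter
  rw [← Finset.prod_mul_distrib]
  refine Finset.prod_pos fun k hk => ?_
  obtain ⟨J, hJ, hxJ, hyJ⟩ := hy.1 k (Finset.mem_range.1 hk)
  obtain ⟨J', hJ', hxJ', hzJ⟩ := hz.1 k (Finset.mem_range.1 hk)
  obtain rfl := eq_of_mem hJ hJ' hxJ hxJ'
  exact deriv_mul_deriv_pos hJ hyJ hzJ

/-! ### Intersections of nested cylinders -/

variable (S) in
/-- The set of points with the same infinite itinerary as `x`. -/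
def core (x : ℝ) : Set ℝ := ⋂ n, S.cyl n x

lemma mem_Icc_of_stays {x : ℝ} (hx : ∀ n, S.Stays n x) : x ∈ Icc (0 : ℝ) 1 :=
  Ioo_subset_Icc_self (J_subset (hx 1 0 (by omega)))

lemma stays_iterate {x : ℝ} (hx : ∀ n, S.Stays n x) (k n : ℕ) : S.Stays n (S.T^[k] x) :=
  (hx (k + n)).iterate

lemma core_eq_pull (n : ℕ) (x : ℝ) : S.core x = S.pull n x (S.core (S.T^[n] x)) := by
  ext z
  constructor
  · intro hz
    have h : ∀ m, z ∈ S.pull n x (S.cyl m (S.T^[n] x)) := fun m => by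
      rw [← cyl_add]
      exact mem_iInter.1 hz _
    exact ⟨(h 0).1, mem_iInter.2 fun m => (h m).2⟩
  · intro hz
    refine mem_iInter.2 fun m => cyl_anti (show m ≤ n + m by omega) x ?_
    rw [cyl_add]
    exact pull_mono (iInter_subset _ m) hz

lemma core_subset_cyl (n : ℕ) (x : ℝ) : S.core x ⊆ S.cyl n x := iInter_subset _ n

lemma core_subset_Icc (x : ℝ) : S.core x ⊆ Icc 0 1 :=
  (core_subset_cyl 0 x).trans (cyl_subset_Icc 0 x)

lemma core_eq_of_mem {x y : ℝ} (h : y ∈ S.core x) : S.core y = S.core x :=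
  iInter_congr fun n => cyl_eq_of_mem (mem_iInter.1 h n)

lemma self_mem_core {x : ℝ} (hx : ∀ n, S.Stays n x) : x ∈ S.core x :=
  mem_iInter.2 fun n => self_mem_cyl (hx n) (mem_Icc_of_stays hx)

lemma ordConnected_core {x : ℝ} (hx : ∀ n, S.Stays n x) : (S.core x).OrdConnected :=
  ordConnected_iInter fun n => ordConnected_cyl (hx n)

lemma isCompact_core {x : ℝ} (hx : ∀ n, S.Stays n x) : IsCompact (S.core x) :=
  isCompact_Icc.of_isClosed_subset (isClosed_iInter fun n => isClosed_cyl (hx n))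
    (core_subset_Icc x)

lemma exists_core_eq_Icc {x : ℝ} (hx : ∀ n, S.Stays n x) : ∃ a b, a ≤ b ∧ S.core x = Icc a b := by
  have hc := isCompact_core hx
  have hne : (S.core x).Nonempty := ⟨x, self_mem_core hx⟩
  obtain ⟨a, ha⟩ := hc.exists_isLeast hne
  obtain ⟨b, hb⟩ := hc.exists_isGreatest hne
  exact ⟨a, b, ha.2 hb.1, Subset.antisymm (fun z hz => ⟨ha.2 hz, hb.2 hz⟩)
    ((ordConnected_core hx).out ha.1 hb.1)⟩

lemma tendsto_len_cyl_core {x : ℝ} (hx : ∀ n, S.Stays n x) :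
    Tendsto (fun n => volume.real (S.cyl n x)) atTop (nhds (volume.real (S.core x))) := by
  have h := tendsto_measure_iInter_atTop (μ := volume) (s := fun n => S.cyl n x)
    (fun n => (ordConnected_cyl (hx n)).measurableSet.nullMeasurableSet)
    (fun m n h => cyl_anti h x) ⟨0, volume_ne_top_of_subset_Icc (cyl_subset_Icc 0 x)⟩
  exact (ENNReal.tendsto_toReal (volume_ne_top_of_subset_Icc (core_subset_Icc x))).comp h

lemma len_core_eq_zero_of_periodic {y : ℝ} (hy : ∀ n, S.Stays n y) {q : ℕ} (hq : 1 ≤ q)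
    (hper : S.T^[q] y ∈ S.core y) : volume.real (S.core y) = 0 := by
  obtain ⟨a, b, hab, hW⟩ := exists_core_eq_Icc hy
  rcases hab.eq_or_lt with rfl | hlt
  · simp [hW, measureReal_def]
  exfalso
  have hpull : S.core y = S.pull q y (S.core y) := by
    conv_lhs => rw [core_eq_pull q, core_eq_of_mem hper]
  have hmaps : ∀ z ∈ S.core y, S.T^[q] z ∈ S.core y := fun z hz => by
    rw [hpull] at hz
    exact hz.2
  have hsurj : ∀ t ∈ S.core y, ∃ z ∈ S.core y, S.T^[q] z = t := fun t ht => by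
    conv in _ ∈ S.core y => rw [hpull]
    exact exists_mem_pull (hy q) ht (core_subset_Icc y ht)
  have hst : ∀ z ∈ S.core y, ∀ n, S.Stays n z := fun z hz n =>
    stays_of_mem_pull (core_subset_cyl n y hz)
  have hpos : ∀ z ∈ S.core y, 0 < derIter S.T (q + q) z := fun z hz => by
    rw [derIter_add]
    exact derIter_mul_derIter_pos (core_subset_cyl q y hz) (core_subset_cyl q y (hmaps z hz))
  have hder : ∀ z ∈ S.core y, HasDerivAt (S.T^[q + q]) (derIter S.T (q + q) z) z := fun z hz =>
    (hst z hz _).hasDerivAt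
  have hmaps2 : ∀ z ∈ S.core y, S.T^[q + q] z ∈ S.core y := fun z hz => by
    rw [Function.iterate_add_apply]
    exact hmaps _ (hmaps z hz)
  have hsurj2 : ∀ t ∈ S.core y, ∃ z ∈ S.core y, S.T^[q + q] z = t := fun t ht => by
    obtain ⟨w, hw, rfl⟩ := hsurj t ht
    obtain ⟨z, hz, rfl⟩ := hsurj w hw
    exact ⟨z, hz, Function.iterate_add_apply ..⟩
  have hmono : StrictMonoOn (S.T^[q + q]) (S.core y) :=
    strictMonoOn_of_deriv_pos (ordConnected_core hy).convex
      (fun z hz => (hder z hz).continuousAt.continuousWithinAt) fun z hz => by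
        rw [(hder z (interior_subset hz)).deriv]
        exact hpos z (interior_subset hz)
  have haW : a ∈ S.core y := by rw [hW]; exact ⟨le_rfl, hab⟩
  have hbW : b ∈ S.core y := by rw [hW]; exact ⟨hab, le_rfl⟩
  have hle : ∀ z ∈ S.core y, a ≤ z ∧ z ≤ b := fun z hz => by
    rw [hW] at hz
    exact hz
  have hga : S.T^[q + q] a = a := by
    obtain ⟨w, hw, hwa⟩ := hsurj2 a haW
    refine le_antisymm ?_ (hle _ (hmaps2 a haW)).1
    calc S.T^[q + q] a ≤ S.T^[q + q] w := hmono.monotoneOn haW hw (hle w hw).1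
      _ = a := hwa
  have hgb : S.T^[q + q] b = b := by
    obtain ⟨w, hw, hwb⟩ := hsurj2 b hbW
    refine le_antisymm (hle _ (hmaps2 b hbW)).2 ?_
    calc b = S.T^[q + q] w := hwb.symm
      _ ≤ S.T^[q + q] b := hmono.monotoneOn hw hbW (hle w hw).2
  rw [hW] at hder hpos hst
  obtain ⟨z, hz, hfix, hle1⟩ := exists_fixed_deriv_le_one hlt hder hga hgb
  have h1 := one_lt_abs_derIter_of_periodic (by omega) (hst z hz _) hfix
  rw [abs_of_pos (hpos z hz)] at h1
  linarith

lemma len_core_pos_iterate {x : ℝ} (hx : ∀ n, S.Stays n x) (hpos : 0 < volume.real (S.core x))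
    (n : ℕ) : 0 < volume.real (S.core (S.T^[n] x)) := by
  have hD := S.hDd
  have h : volume.real (S.core x) ≤ volume.real (S.core (S.T^[n] x)) / ((1 + S.Dd)⁻¹) ^ n := by
    refine len_le_div (n := n) (ordConnected_core hx)
      (fun z hz => stays_of_mem_pull (core_subset_cyl n x hz))
      (ordConnected_core (stays_iterate hx n))
      (volume_ne_top_of_subset_Icc (core_subset_Icc _)) (fun z hz => ?_) (by positivity)
      fun z hz => (stays_of_mem_pull (core_subset_cyl n x hz)).inv_pow_le_abs_derIter
    rw [core_eq_pull n] at hz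
    exact hz.2
  have h2 := hpos.trans_le h
  rwa [lt_div_iff₀ (by positivity), zero_mul] at h2

lemma exists_adjacent_Icc {c d δ : ℝ} (hcd : c ≤ d) (hδ : 0 ≤ δ) (hc : 0 ≤ c) (hd : d ≤ 1)
    (hsum : d - c + 2 * δ ≤ 1) :
    ∃ s, (Icc c d ∪ Icc s (s + δ)).OrdConnected ∧ Icc c d ∪ Icc s (s + δ) ⊆ Icc 0 1 ∧
      Disjoint (Icc c d) (Ioo s (s + δ)) := by
  rcases le_or_gt (d + δ) 1 with h | h
  · refine ⟨d, ?_, ?_, ?_⟩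
    · rw [Icc_union_Icc_eq_Icc hcd (by linarith)]
      exact ordConnected_Icc
    · rw [Icc_union_Icc_eq_Icc hcd (by linarith)]
      exact Icc_subset_Icc hc h
    · exact Set.disjoint_left.2 fun z hz hz' => not_lt_of_ge hz.2 hz'.1
  · refine ⟨c - δ, ?_, ?_, ?_⟩
    · rw [union_comm, sub_add_cancel, Icc_union_Icc_eq_Icc (by linarith) hcd]
      exact ordConnected_Icc
    · rw [union_comm, sub_add_cancel, Icc_union_Icc_eq_Icc (by linarith) hcd]
      exact Icc_subset_Icc (by linarith) hd
    · exact Set.disjoint_left.2 fun z hz hz' => not_lt_of_ge hz.1 (by linarith [hz'.2])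

lemma len_core_add_le {x : ℝ} (hx : ∀ n, S.Stays n x) {n : ℕ}
    (hsum : ∑ i ∈ Finset.range (n + 1), volume.real (S.core (S.T^[i] x)) ≤ 2)
    (hpos : 0 < volume.real (S.core (S.T^[n] x)))
    (hsmall : volume.real (S.core (S.T^[n] x)) ≤ 1 / 3) :
    volume.real (S.core x) + Real.exp (-(S.Dd * 4)) ^ 2 / 3 * volume.real (S.core x) ≤
      volume.real (S.cyl n x) := by
  obtain ⟨a, b, hab, hab'⟩ := exists_core_eq_Icc hx
  obtain ⟨c, d, hcd, hcd'⟩ := exists_core_eq_Icc (stays_iterate hx n)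
  have hlen : volume.real (S.core x) = b - a := by rw [hab', Real.volume_real_Icc_of_le hab]
  have hlen' : volume.real (S.core (S.T^[n] x)) = d - c := by
    rw [hcd', Real.volume_real_Icc_of_le hcd]
  rw [hlen'] at hpos hsmall
  set e := Real.exp (-(S.Dd * 4)) with he
  have he0 : 0 < e := Real.exp_pos _
  have he1 : e ≤ 1 := Real.exp_le_one_iff.2 (by linarith [S.hDd])
  have hee : e * Real.exp (S.Dd * 4) = 1 := by rw [he, ← Real.exp_add]; simp
  have hδ : e * (d - c) ≤ 1 / 3 := by nlinarith
  have hδ0 : 0 < e * (d - c) := by positivity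
  have hsub := core_subset_Icc (S := S) (S.T^[n] x)
  rw [hcd'] at hsub
  obtain ⟨s, hs, hs', hsd⟩ := exists_adjacent_Icc hcd hδ0.le (hsub ⟨le_rfl, hcd⟩).1
    (hsub ⟨hcd, le_rfl⟩).2 (by linarith)
  have hcore : ∀ i ≤ n, S.pull (n - i) (S.T^[i] x) (Icc c d) = S.core (S.T^[i] x) := by
    intro i hi
    rw [core_eq_pull (n - i) (S.T^[i] x), ← Function.iterate_add_apply, Nat.sub_add_cancel hi,
      hcd']
  have hcore0 : S.pull n x (Icc c d) = S.core x := hcore 0 (by omega)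
  obtain ⟨-, hdist⟩ := len_pull_le_two_mul (S := S) ordConnected_Icc hs subset_union_left hs'
    (c := c) (d := d) ⟨le_rfl, hcd⟩ ⟨hcd, le_rfl⟩ (by intro h; linarith)
    (by
      intro y hy z hz
      have h1 := hy.1.resolve_left hy.2
      have h2 := hz.1.resolve_left hz.2
      rw [abs_sub_comm c d, abs_of_pos hpos, abs_le]
      constructor <;> linarith [h1.1, h1.2, h2.1, h2.2])
    (hx n) (by
      refine le_trans (le_of_eq ?_) hsum
      exact Finset.sum_congr rfl fun i hi => by
        rw [hcore i (by have := Finset.mem_range.1 hi; omega)])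
  have hIoo : Ioo s (s + e * (d - c)) ⊆ Icc c d ∪ Icc s (s + e * (d - c)) :=
    Ioo_subset_Icc_self.trans subset_union_right
  obtain ⟨u, hu, hu'⟩ := exists_mem_pull (hx n) (C := Ioo s (s + e * (d - c)))
    (t := s + e * (d - c) / 3) ⟨by linarith, by linarith⟩
    (hs' (hIoo ⟨by linarith, by linarith⟩))
  obtain ⟨v, hv, hv'⟩ := exists_mem_pull (hx n) (C := Ioo s (s + e * (d - c)))
    (t := s + 2 * (e * (d - c)) / 3) ⟨by linarith, by linarith⟩
    (hs' (hIoo ⟨by linarith, by linarith⟩))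
  set Q := S.pull n x (Ioo s (s + e * (d - c))) with hQ
  have hQord : Q.OrdConnected := ordConnected_pull (hx n) ordConnected_Ioo
  have hQsub : Q ⊆ S.cyl n x := pull_mono (hIoo.trans hs')
  have hQdisj : Disjoint (S.core x) Q := by
    rw [← hcore0]
    exact Set.disjoint_left.2 fun z hz hz' => Set.disjoint_left.1 hsd hz.2 hz'.2
  obtain ⟨ξ, hξ, h⟩ := Stays.exists_abs_sub_eq hQord (fun w hw => stays_of_mem_pull hw) hu hv
  have huv := abs_sub_le_len hQord
    (volume_ne_top_of_subset_Icc (hQsub.trans (cyl_subset_Icc n x))) hu hv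
  rw [hu', hv', show s + e * (d - c) / 3 - (s + 2 * (e * (d - c)) / 3) = -(e * (d - c) / 3) by ring,
    abs_neg, abs_of_pos (by positivity)] at h
  have ha : a ∈ S.core x := by rw [hab']; exact ⟨le_rfl, hab⟩
  have hb : b ∈ S.core x := by rw [hab']; exact ⟨hab, le_rfl⟩
  obtain ⟨ζ, hζ, h'⟩ := Stays.exists_abs_sub_eq (ordConnected_core hx)
    (fun w hw => stays_of_mem_pull (core_subset_cyl n x hw)) hb ha
  rw [← hcore0] at ha hb hζ
  have hℓ : |S.T^[n] b - S.T^[n] a| ≤ d - c := by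
    rw [abs_le]
    constructor <;> linarith [ha.2.1, ha.2.2, hb.2.1, hb.2.2]
  rw [h', abs_of_nonneg (sub_nonneg.2 hab)] at hℓ
  have hdξ := hdist ξ (pull_mono hIoo hξ) ζ (pull_mono subset_union_left hζ)
  have hQlen : e ^ 2 / 3 * (b - a) ≤ volume.real Q := by
    refine le_of_mul_le_mul_left ?_ hpos
    calc (d - c) * (e ^ 2 / 3 * (b - a)) = e * (b - a) * (e * (d - c) / 3) := by ring
      _ = e * (b - a) * (|derIter S.T n ξ| * |u - v|) := by rw [h]
      _ ≤ e * (b - a) * ((|derIter S.T n ζ| * Real.exp (S.Dd * 4)) * volume.real Q) := by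
          have := sub_nonneg.2 hab
          gcongr
      _ = (e * Real.exp (S.Dd * 4)) * (|derIter S.T n ζ| * (b - a)) * volume.real Q := by ring
      _ ≤ 1 * (d - c) * volume.real Q := by rw [hee]; gcongr
      _ = _ := by ring
  calc volume.real (S.core x) + e ^ 2 / 3 * volume.real (S.core x)
      ≤ volume.real (S.core x) + volume.real Q := by rw [hlen]; gcongr
    _ = volume.real (S.core x ∪ Q) :=
        (measureReal_union hQdisj hQord.measurableSet
          (volume_ne_top_of_subset_Icc (core_subset_Icc x))
          (volume_ne_top_of_subset_Icc (hQsub.trans (cyl_subset_Icc n x)))).symm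
    _ ≤ _ := measureReal_mono (union_subset (core_subset_cyl n x) hQsub)
        (volume_ne_top_of_subset_Icc (cyl_subset_Icc n x))

lemma len_core_eq_zero {x : ℝ} (hx : ∀ n, S.Stays n x) : volume.real (S.core x) = 0 := by
  by_contra hne
  have hpos : 0 < volume.real (S.core x) := lt_of_le_of_ne measureReal_nonneg (Ne.symm hne)
  by_cases hper : ∃ j k, j < k ∧ S.T^[k] x ∈ S.core (S.T^[j] x)
  · obtain ⟨j, k, hjk, h⟩ := hper
    rw [← Nat.sub_add_cancel hjk.le, Function.iterate_add_apply] at h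
    exact (len_core_pos_iterate hx hpos j).ne'
      (len_core_eq_zero_of_periodic (stays_iterate hx j) (by omega) h)
  push Not at hper
  have hdisj : ∀ j k, j < k → Disjoint (S.core (S.T^[j] x)) (S.core (S.T^[k] x)) := by
    intro j k hjk
    refine Set.disjoint_left.2 fun z hz hz' => hper j k hjk ?_
    rw [← core_eq_of_mem hz, core_eq_of_mem hz']
    exact self_mem_core (stays_iterate hx k)
  have hsum : ∀ n, ∑ i ∈ Finset.range n, volume.real (S.core (S.T^[i] x)) ≤ 1 := fun n =>
    sum_len_le_one _ _ (fun i _ => (ordConnected_core (stays_iterate hx i)).measurableSet)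
      (fun i _ => core_subset_Icc _) fun j _ k _ hjk => by
        rcases lt_or_gt_of_ne hjk with h | h
        · exact hdisj j k h
        · exact (hdisj k j h).symm
  have htend := (summable_of_sum_range_le (fun _ => measureReal_nonneg) hsum).tendsto_atTop_zero
  set e := Real.exp (-(S.Dd * 4)) with he
  have he0 : 0 < e := Real.exp_pos _
  have h1 := htend.eventually (gt_mem_nhds (show (0 : ℝ) < 1 / 3 by norm_num))
  have h2 := (tendsto_len_cyl_core hx).eventually (gt_mem_nhds
    (show volume.real (S.core x) < volume.real (S.core x) + e ^ 2 / 3 * volume.real (S.core x) by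
      have : 0 < e ^ 2 / 3 * volume.real (S.core x) := by positivity
      linarith))
  obtain ⟨n, hn1, hn2⟩ := (h1.and h2).exists
  exact absurd (len_core_add_le hx ((hsum _).trans (by norm_num))
    (len_core_pos_iterate hx hpos n) hn1.le) (not_le_of_gt hn2)

lemma tendsto_len_cyl {x : ℝ} (hx : ∀ n, S.Stays n x) :
    Tendsto (fun n => volume.real (S.cyl n x)) atTop (nhds 0) := by
  simpa [len_core_eq_zero hx] using tendsto_len_cyl_core hx

/-! ### Uniform decay of cylinders and short branches -/

lemma finite_of_le_len {F : Set (Set ℝ)} {ε : ℝ} (hε : 0 < ε)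
    (hF : ∀ A ∈ F, MeasurableSet A ∧ A ⊆ Icc 0 1 ∧ ε ≤ volume.real A)
    (hd : F.PairwiseDisjoint id) : F.Finite := by
  by_contra hinf
  obtain ⟨m, hm⟩ := exists_nat_gt (1 / ε)
  obtain ⟨t, ht, hcard⟩ := Set.Infinite.exists_subset_card_eq hinf m
  have h1 := sum_len_le_one t id (fun A hA => (hF A (ht hA)).1) (fun A hA => (hF A (ht hA)).2.1)
    (hd.subset ht)
  have h2 : m • ε ≤ ∑ A ∈ t, volume.real (id A) := by
    rw [← hcard]
    exact Finset.card_nsmul_le_sum _ _ _ fun A hA => (hF A (ht hA)).2.2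
  rw [nsmul_eq_mul] at h2
  rw [div_lt_iff₀ hε] at hm
  linarith

lemma exists_len_cyl_lt (S : InducedSetup) {ε : ℝ} (hε : 0 < ε) :
    ∃ N, ∀ x, S.Stays N x → volume.real (S.cyl N x) < ε := by
  by_contra! h
  set X : ℕ → Set ℝ := fun n => {x | S.Stays (n + 1) x ∧ ε ≤ volume.real (S.cyl (n + 1) x)} with hX
  have hIcc : ∀ n, X n ⊆ Icc 0 1 := fun n x hx =>
    Ioo_subset_Icc_self (J_subset (hx.1 0 (by omega)))
  have hclosed : ∀ n, IsClosed (X n) := by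
    intro n
    have hfin : (S.cyl (n + 1) '' X n).Finite := by
      refine finite_of_le_len hε ?_ ?_
      · rintro _ ⟨x, hx, rfl⟩
        exact ⟨(ordConnected_cyl hx.1).measurableSet, cyl_subset_Icc _ _, hx.2⟩
      · rintro _ ⟨x, hx, rfl⟩ _ ⟨y, hy, rfl⟩ hne
        refine Set.disjoint_left.2 fun z hz hz' => hne ?_
        rw [← cyl_eq_of_mem hz, ← cyl_eq_of_mem hz']
    have hunion : X n = ⋃ A ∈ S.cyl (n + 1) '' X n, A := by
      ext z
      simp only [mem_iUnion, exists_prop, exists_mem_image]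
      constructor
      · exact fun hz => ⟨z, hz, self_mem_cyl hz.1 (hIcc n hz)⟩
      · rintro ⟨x, hx, hz⟩
        refine ⟨stays_of_mem_pull hz, ?_⟩
        rw [cyl_eq_of_mem hz]
        exact hx.2
    rw [hunion]
    refine hfin.isClosed_biUnion ?_
    rintro _ ⟨x, hx, rfl⟩
    exact isClosed_cyl hx.1
  obtain ⟨x, hx⟩ := IsCompact.nonempty_iInter_of_sequence_nonempty_isCompact_isClosed X
    (fun n x hx => ⟨hx.1.mono (by omega), hx.2.trans (measureReal_mono (cyl_anti (by omega) x)
      (volume_ne_top_of_subset_Icc (cyl_subset_Icc _ x)))⟩)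
    (fun n => h (n + 1)) (isCompact_Icc.of_isClosed_subset (hclosed 0) (hIcc 0)) hclosed
  rw [mem_iInter] at hx
  have hst : ∀ n, S.Stays n x := fun n => (hx n).1.mono (by omega)
  obtain ⟨n, hn⟩ := (((tendsto_add_atTop_iff_nat 1).2 (tendsto_len_cyl hst)).eventually
    (gt_mem_nhds hε)).exists
  exact absurd (hx n).2 (not_le_of_gt hn)

lemma exists_two_le_abs_derIter (S : InducedSetup) : ∃ η > 0, ∀ (x : ℝ) (k : ℕ),
    S.Stays (k + 1) x → (∀ J ∈ S.Nfam, S.T^[k] x ∈ J → volume.real J < η) →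
    (∀ i < k, ∀ J ∈ S.Nfam, S.T^[i] x ∈ J → η ≤ volume.real J) →
    2 ≤ |derIter S.T (k + 1) x| := by
  have hD := S.hDd
  set c := Real.exp (-(S.Dd * 2)) / 2 with hc
  have hc0 : 0 < c := by positivity
  obtain ⟨N, hN⟩ := exists_len_cyl_lt S hc0
  refine ⟨c * ((1 + S.Dd)⁻¹) ^ N, by positivity, fun x k hx hsmall hbig => ?_⟩
  have hxI : x ∈ Icc (0 : ℝ) 1 := Ioo_subset_Icc_self (J_subset (hx 0 (by omega)))
  obtain ⟨J, hJ, hkJ⟩ := hx k (by omega)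
  have hlen : S.lenSum (k + 1) x ≤ 2 := by
    refine (lenSum_le_of_first hx hxI fun i hi hmem => ?_).trans ?_
    · obtain ⟨J', hJ', hi', hk'⟩ := hmem.1 0 (by omega)
      exact absurd (hbig i hi J' hJ' hi') (not_le_of_gt (hsmall J' hJ' hk'))
    · have := lenSum_le_self (S := S) 1 (S.T^[k] x)
      push_cast at this
      linarith
  have hcyl : volume.real (S.cyl (k + 1) x) ≤ c := by
    rcases le_or_gt N (k + 1) with h | h
    · exact (measureReal_mono (cyl_anti h x) (volume_ne_top_of_subset_Icc
        (cyl_subset_Icc _ x))).trans (hN x (hx.mono h)).le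
    · have h1 : volume.real (S.cyl (k + 1) x) ≤ volume.real J / ((1 + S.Dd)⁻¹) ^ k := by
        refine len_le_div (n := k) (ordConnected_cyl hx)
          (fun z hz => (stays_of_mem_pull hz).mono (by omega)) (S.hN J hJ).2.1
          (S.hN J hJ).1.measure_ne_top (fun z hz => ?_) (by positivity)
          fun z hz => ((stays_of_mem_pull hz).mono (by omega)).inv_pow_le_abs_derIter
        obtain ⟨J', hJ', hx', hz'⟩ := hz.1 k (by omega)
        rwa [eq_of_mem hJ hJ' hkJ hx']
      refine h1.trans ?_
      rw [div_le_iff₀ (by positivity)]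
      refine (hsmall J hJ hkJ).le.trans ?_
      refine mul_le_mul_of_nonneg_left (pow_le_pow_of_le_one (by positivity) ?_ (by omega)) hc0.le
      exact inv_le_one_of_one_le₀ (by linarith)
  have h := one_le_abs_derIter_mul hx hxI hlen
  have h2 : Real.exp (S.Dd * 2) * volume.real (S.cyl (k + 1) x) ≤ 1 / 2 := by
    calc _ ≤ Real.exp (S.Dd * 2) * c := by gcongr
      _ = Real.exp (S.Dd * 2) * Real.exp (-(S.Dd * 2)) / 2 := by rw [hc]; ring
      _ = 1 / 2 := by rw [← Real.exp_add]; simp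
  nlinarith [abs_nonneg (derIter S.T (k + 1) x)]

/-! ### Orbits with bounded derivative -/

lemma exists_one_lt_abs_derIter {x : ℝ} (hx : ∀ n, S.Stays n x) {M : ℝ}
    (h : ∀ L₀, ∃ L ≥ L₀, ∃ i, S.lenSum L (S.T^[i] x) ≤ M) : ∃ m, 1 < |derIter S.T m x| := by
  have hxI := mem_Icc_of_stays hx
  set E := Real.exp (S.Dd * (1 + M)) with hE
  have hE0 : 0 < E := Real.exp_pos _
  have hlim : Tendsto (fun n => E * volume.real (S.cyl n x)) atTop (nhds 0) := by
    simpa using (tendsto_len_cyl hx).const_mul E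
  obtain ⟨L₀, hL₀⟩ := eventually_atTop.1 (hlim.eventually (gt_mem_nhds one_pos))
  obtain ⟨L, hL, i, hi⟩ := h L₀
  have hself : ∀ k, S.T^[k] x ∈ S.cyl L (S.T^[k] x) := fun k =>
    self_mem_cyl (stays_iterate hx k L) (mem_Icc_of_stays (stays_iterate hx k))
  have hex : ∃ j, S.T^[j] x ∈ S.cyl L (S.T^[i] x) := ⟨i, hself i⟩
  classical
  set j := Nat.find hex with hj
  have hjm : S.T^[j] x ∈ S.cyl L (S.T^[i] x) := Nat.find_spec hex
  have hsum : S.lenSum (j + L) x ≤ 1 + M := by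
    refine (lenSum_le_of_first (hx _) hxI fun k hk hmem => Nat.find_min hex hk ?_).trans ?_
    · rw [← cyl_eq_of_mem hjm, cyl_eq_of_mem hmem]
      exact hself k
    · rw [lenSum_eq_of_mem hjm]
      gcongr
  refine ⟨j + L, ?_⟩
  have h1 := one_le_abs_derIter_mul (hx (j + L)) hxI hsum
  have h2 := hL₀ (j + L) (by omega)
  have h3 : 0 ≤ E * volume.real (S.cyl (j + L) x) := by positivity
  by_contra hle
  rw [not_lt] at hle
  have := mul_le_mul_of_nonneg_right hle h3
  rw [← hE] at h1
  linarith

lemma sum_range_le_of_le_mul {a : ℕ → ℝ} {r : ℝ} {n₀ q : ℕ} (ha : ∀ n, 0 ≤ a n) (ha' : ∀ n, a n ≤ 1)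
    (hr : 0 ≤ r) (hr' : r < 1) (h : ∀ n ≥ n₀, a (q + n) ≤ r * a n) (N : ℕ) :
    ∑ n ∈ Finset.range N, a n ≤ (n₀ + q : ℕ) / (1 - r) := by
  set b := n₀ + q with hb
  have hmono : ∀ {m n : ℕ}, m ≤ n → ∑ k ∈ Finset.range m, a k ≤ ∑ k ∈ Finset.range n, a k :=
    fun hmn => Finset.sum_le_sum_of_subset_of_nonneg (Finset.range_mono hmn) fun k _ _ => ha k
  refine (hmono (show N ≤ b + N by omega)).trans ?_
  rw [le_div_iff₀ (by linarith)]
  have h1 : ∑ k ∈ Finset.range b, a k ≤ b := by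
    calc ∑ k ∈ Finset.range b, a k ≤ ∑ k ∈ Finset.range b, (1 : ℝ) :=
          Finset.sum_le_sum fun k _ => ha' k
      _ = b := by simp
  have h2 : ∑ k ∈ Finset.range N, a (b + k) ≤ r * ∑ k ∈ Finset.range (b + N), a k := by
    calc ∑ k ∈ Finset.range N, a (b + k) ≤ ∑ k ∈ Finset.range N, r * a (n₀ + k) :=
          Finset.sum_le_sum fun k _ => by
            rw [show b + k = q + (n₀ + k) by omega]
            exact h _ (by omega)
      _ = r * ∑ k ∈ Finset.range N, a (n₀ + k) := by rw [Finset.mul_sum]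
      _ ≤ r * ∑ k ∈ Finset.range (n₀ + N), a k := by
          rw [Finset.sum_range_add]
          gcongr
          exact le_add_of_nonneg_left (Finset.sum_nonneg fun k _ => ha k)
      _ ≤ _ := mul_le_mul_of_nonneg_left (hmono (by omega)) hr
  rw [Finset.sum_range_add] at h2 ⊢
  linarith

lemma exists_sum_len_cyl_le_of_periodic {z : ℝ} (hz : ∀ n, S.Stays n z) {q : ℕ} (hq : 1 ≤ q)
    (hper : S.T^[q] z = z) : ∃ M, ∀ N, ∑ n ∈ Finset.range N, volume.real (S.cyl n z) ≤ M := by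
  have hl := one_lt_abs_derIter_of_periodic hq (hz q) hper
  set l := |derIter S.T q z| with hldef
  set l' := (1 + l) / 2 with hl'
  have hl1 : 1 < l' := by linarith
  have hlim : Tendsto (fun n => l' * Real.exp (S.Dd *
      ∑ i ∈ Finset.range q, volume.real (S.cyl n (S.T^[i + 1] z)))) atTop (nhds l') := by
    have h0 : Tendsto (fun n => ∑ i ∈ Finset.range q, volume.real (S.cyl n (S.T^[i + 1] z)))
        atTop (nhds 0) := by
      simpa using tendsto_finsetSum (Finset.range q) fun i _ =>
        tendsto_len_cyl (stays_iterate hz (i + 1))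
    simpa using ((Real.continuous_exp.tendsto _).comp (h0.const_mul S.Dd)).const_mul l'
  obtain ⟨n₀, hn₀⟩ := eventually_atTop.1 (hlim.eventually (gt_mem_nhds (show l' < l by linarith)))
  refine ⟨_, sum_range_le_of_le_mul (n₀ := n₀) (q := q) (r := l'⁻¹) (fun _ => measureReal_nonneg)
    (fun n => len_le_one_of_subset_Icc (cyl_subset_Icc n z)) (by positivity)
    (inv_lt_one_of_one_lt₀ hl1) fun n hn => ?_⟩
  rw [mul_comm, ← div_eq_mul_inv]
  refine len_le_div (n := q) (ordConnected_cyl (hz _))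
    (fun y hy => (stays_of_mem_pull hy).mono (by omega)) (ordConnected_cyl (hz n))
    (volume_ne_top_of_subset_Icc (cyl_subset_Icc n z)) (fun y hy => ?_) (by positivity)
    fun y hy => ?_
  · simpa only [hper] using iterate_mem_cyl hy
  · have hzm := self_mem_cyl (hz (q + n)) (mem_Icc_of_stays hz)
    have h := abs_derIter_le_of_sum_le (M := ∑ i ∈ Finset.range q,
        volume.real (S.cyl n (S.T^[i + 1] z))) (cyl_anti (by omega) z hzm : z ∈ S.cyl q z)
      (cyl_anti (by omega) z hy) (Finset.sum_le_sum fun i hi => by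
        have hi' := Finset.mem_range.1 hi
        rw [abs_sub_comm]
        refine (abs_sub_iterate_le (show i < q + n by omega) (hz _) ordConnected_Icc subset_rfl
          hy hzm).trans ?_
        exact measureReal_mono (cyl_anti (by omega) _)
          (volume_ne_top_of_subset_Icc (cyl_subset_Icc _ _)))
    have h2 := (hn₀ n hn).trans_le h
    exact (lt_of_mul_lt_mul_right h2 (Real.exp_pos _).le).le

lemma exists_lenSum_le_of_periodic {z : ℝ} (hz : ∀ n, S.Stays n z) {q : ℕ} (hq : 1 ≤ q)
    (hper : S.T^[q] z = z) : ∃ M, ∀ L, S.lenSum L z ≤ M := by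
  have h : ∀ r, ∃ M, ∀ N, ∑ n ∈ Finset.range N, volume.real (S.cyl n (S.T^[r] z)) ≤ M := fun r =>
    exists_sum_len_cyl_le_of_periodic (stays_iterate hz r) hq (by
      rw [← Function.iterate_add_apply, add_comm, Function.iterate_add_apply, hper])
  choose M hM using h
  refine ⟨∑ r ∈ Finset.range q, M r, fun L => ?_⟩
  calc S.lenSum L z
      ≤ ∑ i ∈ Finset.range L, ∑ r ∈ Finset.range q,
          volume.real (S.cyl (L - 1 - i) (S.T^[r] z)) := by
        refine Finset.sum_le_sum fun i _ => ?_
        rw [← Function.IsPeriodicPt.iterate_mod_apply (n := q) hper (i + 1)]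
        exact Finset.single_le_sum
          (f := fun r => volume.real (S.cyl (L - 1 - i) (S.T^[r] z)))
          (fun _ _ => measureReal_nonneg) (Finset.mem_range.2 (Nat.mod_lt _ hq))
    _ = ∑ r ∈ Finset.range q, ∑ i ∈ Finset.range L,
          volume.real (S.cyl (L - 1 - i) (S.T^[r] z)) := Finset.sum_comm
    _ ≤ _ := Finset.sum_le_sum fun r _ => by
        rw [Finset.sum_range_reflect fun n => volume.real (S.cyl n (S.T^[r] z))]
        exact hM r L

/-! ### Limit sets -/

lemma exists_eventually_mem_of_tendsto {B : Set (Set ℝ)} (hB : B.Finite)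
    (hcl : ∀ J ∈ B, IsClosed J) {𝒰 : Ultrafilter ℕ} {v : ℕ → ℝ} {y : ℝ}
    (hv : ∀ n, v n ∈ ⋃₀ B) (h : Tendsto v 𝒰 (nhds y)) :
    ∃ J ∈ B, y ∈ J ∧ ∀ᶠ n in (𝒰 : Filter ℕ), v n ∈ J := by
  have hU : (⋃ J ∈ B, v ⁻¹' J) ∈ 𝒰 := by
    refine univ_mem' fun n => ?_
    obtain ⟨J, hJ, hn⟩ := hv n
    exact mem_biUnion hJ hn
  obtain ⟨J, hJ, hJ'⟩ := (Ultrafilter.finite_biUnion_mem_iff hB).1 hU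
  exact ⟨J, hJ, (hcl J hJ).mem_of_tendsto h hJ', hJ'⟩

lemma exists_limit_set {B : Set (Set ℝ)} (hB : B.Finite) (hBN : B ⊆ S.Nfam) {x : ℝ}
    (hx : ∀ k, S.T^[k] x ∈ ⋃₀ B) :
    ∃ K : Set ℝ, K.Nonempty ∧ IsCompact K ∧ (∀ y ∈ K, ∀ n, S.Stays n y) ∧ MapsTo S.T K K ∧
      SurjOn S.T K K ∧ ∀ y ∈ K, ∀ L, ∃ i, S.T^[i] x ∈ S.cyl L y := by
  have hcl : ∀ J ∈ B, IsClosed J := fun J hJ => (S.hN J (hBN hJ)).1.isClosed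
  have hU : IsCompact (⋃₀ B) := hB.isCompact_sUnion fun J hJ => (S.hN J (hBN hJ)).1
  have hUJ : ⋃₀ B ⊆ S.J := sUnion_subset_sUnion hBN
  set u : ℕ → ℝ := fun n => S.T^[n] x with hu
  have hsucc : ∀ n, u (n + 1) = S.T (u n) := fun n => Function.iterate_succ_apply' _ _ _
  set K : Set ℝ := {y | MapClusterPt y atTop u} with hK
  have hKiff : ∀ y, y ∈ K ↔ ∃ 𝒰 : Ultrafilter ℕ, (𝒰 : Filter ℕ) ≤ atTop ∧ Tendsto u 𝒰 (nhds y) :=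
    fun y => mapClusterPt_iff_ultrafilter
  have hKU : K ⊆ ⋃₀ B := by
    intro y hy
    obtain ⟨𝒰, -, h⟩ := (hKiff y).1 hy
    obtain ⟨J, hJ, hyJ, -⟩ := exists_eventually_mem_of_tendsto hB hcl hx h
    exact ⟨J, hJ, hyJ⟩
  have hmaps : MapsTo S.T K K := by
    intro y hy
    obtain ⟨𝒰, h𝒰, h⟩ := (hKiff y).1 hy
    refine (hKiff _).2 ⟨𝒰.map (· + 1), ?_, ?_⟩
    · rw [Ultrafilter.coe_map]
      exact (tendsto_add_atTop_nat 1).mono_left h𝒰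
    · rw [Ultrafilter.coe_map, tendsto_map'_iff]
      have := (continuousAt_T (hUJ (hKU hy))).tendsto.comp h
      exact this.congr fun n => (hsucc n).symm
  have hst : ∀ y ∈ K, ∀ n, S.Stays n y := fun y hy n k _ => hUJ (hKU (hmaps.iterate k hy))
  refine ⟨K, ?_, ?_, hst, hmaps, ?_, ?_⟩
  · obtain ⟨y, -, hy⟩ := hU.exists_mapClusterPt_of_frequently (l := atTop) (f := u)
      (Eventually.of_forall hx).frequently
    exact ⟨y, hy⟩
  · exact hU.of_isClosed_subset isClosed_setOfPred_clusterPt hKU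
  · intro y hy
    obtain ⟨𝒰, h𝒰, h⟩ := (hKiff y).1 hy
    obtain ⟨z, -, hz⟩ := hU.ultrafilter_le_nhds' ((𝒰.map (· - 1)).map u)
      (mem_map.2 (univ_mem' fun n => hx n))
    have hz' : Tendsto u (𝒰.map (· - 1) : Ultrafilter ℕ) (nhds z) := hz
    have hzK : z ∈ K := by
      refine (hKiff z).2 ⟨𝒰.map (· - 1), ?_, hz'⟩
      rw [Ultrafilter.coe_map]
      exact (tendsto_sub_atTop_nat 1).mono_left h𝒰
    refine ⟨z, hzK, tendsto_nhds_unique (f := u) (l := (𝒰 : Filter ℕ)) ?_ h⟩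
    rw [Ultrafilter.coe_map, tendsto_map'_iff] at hz'
    refine ((continuousAt_T (hUJ (hKU hzK))).tendsto.comp hz').congr' ?_
    filter_upwards [h𝒰 (eventually_ge_atTop 1)] with n hn
    simp only [Function.comp_apply]
    rw [← hsucc, Nat.sub_add_cancel hn]
  · intro y hy L
    obtain ⟨𝒰, h𝒰, h⟩ := (hKiff y).1 hy
    have hk : ∀ k ∈ Finset.range L, ∀ᶠ n in (𝒰 : Filter ℕ),
        ∃ J ∈ S.Nfam, S.T^[k] y ∈ J ∧ S.T^[k] (u n) ∈ J := by
      intro k _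
      obtain ⟨J, hJ, hyJ, hev⟩ := exists_eventually_mem_of_tendsto hB hcl
        (v := fun n => S.T^[k] (u n)) (fun n => by
          rw [hu, ← Function.iterate_add_apply]
          exact hx _) ((hst y hy k).hasDerivAt.continuousAt.tendsto.comp h)
      filter_upwards [hev] with n hn
      exact ⟨J, hBN hJ, hyJ, hn⟩
    obtain ⟨n, hn⟩ := ((Finset.eventually_all _).2 hk).exists
    refine ⟨n, fun k hk => hn k (Finset.mem_range.2 hk), ?_⟩
    rw [← Function.iterate_add_apply]
    exact Ioo_subset_Icc_self (J_subset (hUJ (hx _)))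

/-! ### Backward orbits in a limit set without periodic points -/

lemma sum_len_le_two {y : ℕ → ℝ} (hy : Function.Injective y) {G : ℕ → Set ℝ}
    (hord : ∀ n, (G n).OrdConnected) (hG : ∀ n, G n ⊆ Icc 0 1)
    (hself : ∀ n, y n ∈ G n) (hmem : ∀ m n, y m ∈ G n → m = n) (N : ℕ) :
    ∑ n ∈ Finset.range N, volume.real (G n) ≤ 2 := by
  have hR : ∑ n ∈ Finset.range N, volume.real (G n ∩ Ici (y n)) ≤ 1 := by
    refine sum_len_le_one _ _ (fun n _ => (hord n).measurableSet.inter measurableSet_Ici)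
      (fun n _ => inter_subset_left.trans (hG n)) fun m _ n _ hmn => ?_
    refine Set.disjoint_left.2 fun z hz hz' => ?_
    rcases lt_or_gt_of_ne (hy.ne hmn) with h | h
    · exact hmn (hmem n m ((hord m).out (hself m) hz.1 ⟨h.le, hz'.2⟩)).symm
    · exact hmn (hmem m n ((hord n).out (hself n) hz'.1 ⟨h.le, hz.2⟩))
  have hL : ∑ n ∈ Finset.range N, volume.real (G n ∩ Iic (y n)) ≤ 1 := by
    refine sum_len_le_one _ _ (fun n _ => (hord n).measurableSet.inter measurableSet_Iic)
      (fun n _ => inter_subset_left.trans (hG n)) fun m _ n _ hmn => ?_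
    refine Set.disjoint_left.2 fun z hz hz' => ?_
    rcases lt_or_gt_of_ne (hy.ne hmn) with h | h
    · exact hmn (hmem m n ((hord n).out hz'.1 (hself n) ⟨hz.2, h.le⟩))
    · exact hmn (hmem n m ((hord m).out hz.1 (hself m) ⟨hz'.2, h.le⟩)).symm
  calc ∑ n ∈ Finset.range N, volume.real (G n)
      ≤ ∑ n ∈ Finset.range N,
          (volume.real (G n ∩ Ici (y n)) + volume.real (G n ∩ Iic (y n))) := by
        refine Finset.sum_le_sum fun n _ => ?_
        refine le_trans (le_of_eq ?_) (measureReal_union_le _ _)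
        rw [← inter_union_distrib_left, union_comm, Iic_union_Ici, inter_univ]
    _ ≤ 2 := by
        rw [Finset.sum_add_distrib]
        linarith

lemma exists_lenSum_le_of_no_periodic {K : Set ℝ} (hne : K.Nonempty) (hK : IsCompact K)
    (hst : ∀ y ∈ K, ∀ n, S.Stays n y) (hmaps : MapsTo S.T K K) (hsurj : SurjOn S.T K K)
    (hper : ∀ y ∈ K, ∀ q, 1 ≤ q → S.T^[q] y ≠ y) :
    ∃ M, ∀ L₀, ∃ L ≥ L₀, ∃ y ∈ K, S.lenSum L y ≤ M := by
  obtain ⟨α, hα, hmax⟩ := hK.exists_isGreatest hne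
  have hαI : α ∈ Ioo (0 : ℝ) 1 := J_subset (hst α hα 1 0 (by omega))
  choose! pre hpreK hpre using hsurj
  set y : ℕ → ℝ := fun n => pre^[n] α with hy
  have hyK : ∀ n, y n ∈ K := by
    intro n
    induction n with
    | zero => exact hα
    | succ n ih =>
      rw [hy]
      simp only [Function.iterate_succ_apply']
      exact hpreK ih
  have hyT : ∀ n, S.T (y (n + 1)) = y n := by
    intro n
    rw [hy]
    simp only [Function.iterate_succ_apply']
    exact hpre (hyK n)
  have hyiter : ∀ i n, S.T^[i] (y (n + i)) = y n := by
    intro i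
    induction i with
    | zero => simp
    | succ i ih =>
      intro n
      rw [Function.iterate_succ_apply, ← add_assoc, hyT, ih]
  have hlt : ∀ m n, m < n → y m ≠ y n := by
    intro m n hmn h
    have h1 := hyiter (n - m) m
    rw [Nat.add_sub_cancel' hmn.le, h] at h1
    exact hper _ (hyK n) _ (by omega) h1
  have hinj : Function.Injective y := by
    intro m n h
    by_contra hne
    rcases lt_or_gt_of_ne hne with h' | h'
    · exact hlt m n h' h
    · exact hlt n m h' h.symm
  have hy0 : ∀ n, S.T^[n] (y n) = α := fun n => by simpa [hy] using hyiter n 0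
  set G : ℕ → Set ℝ := fun n => S.pull n (y n) (Icc α 1) with hG
  have hαsub : Icc α 1 ⊆ Icc (0 : ℝ) 1 := Icc_subset_Icc_left hαI.1.le
  have hself : ∀ n, y n ∈ G n := fun n =>
    self_mem_pull (hst _ (hyK n) n) (by rw [hy0]; exact ⟨le_rfl, hαI.2.le⟩)
  have hsum : ∀ N, ∑ n ∈ Finset.range N, volume.real (G n) ≤ 2 := by
    refine sum_len_le_two hinj (fun n => ordConnected_pull (hst _ (hyK n) n) ordConnected_Icc)
      (fun n => pull_subset_Icc hαsub) hself fun m n hmn => hinj ?_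
    refine injOn_pull (hst _ (hyK n) n) hmn (hself n) ?_
    rw [hy0]
    exact le_antisymm (hmax (hmaps.iterate n (hyK m))) hmn.2.1
  set δ := Real.exp (-(S.Dd * 4)) * (1 - α) with hδ
  have hδ0 : 0 < δ := mul_pos (Real.exp_pos _) (by linarith [hαI.2])
  set E : Set ℝ := Icc (max 0 (α - δ)) 1 with hE
  have hpull : ∀ n, volume.real (S.pull n (y n) E) ≤ 2 * volume.real (G n) := by
    intro n
    refine (len_pull_le_two_mul (C := Icc α 1) (E := E) ordConnected_Icc ordConnected_Icc
      (Icc_subset_Icc_left (max_le hαI.1.le (by linarith)))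
      (Icc_subset_Icc_left (le_max_left _ _)) (c := α) (d := 1) ⟨le_rfl, hαI.2.le⟩
      ⟨hαI.2.le, le_rfl⟩ hαI.2.ne ?_ (hst _ (hyK n) n) ?_).1
    · rintro s ⟨hs, hs'⟩ t ⟨ht, ht'⟩
      have h1 : s < α := lt_of_not_ge fun h => hs' ⟨h, hs.2⟩
      have h2 : t < α := lt_of_not_ge fun h => ht' ⟨h, ht.2⟩
      have h3 := (le_max_right _ _).trans hs.1
      have h4 := (le_max_right _ _).trans ht.1
      rw [abs_sub_comm α 1, abs_of_pos (sub_pos.2 hαI.2), ← hδ, abs_le]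
      constructor <;> linarith
    · refine le_trans (le_of_eq ?_) (hsum (n + 1))
      rw [← Finset.sum_range_reflect (fun n => volume.real (G n))]
      refine Finset.sum_congr rfl fun i hi => ?_
      have hi' := Finset.mem_range.1 hi
      have h := hyiter i (n - i)
      rw [Nat.sub_add_cancel (by omega)] at h
      rw [h, show n + 1 - 1 - i = n - i by omega]
  obtain ⟨L, hL⟩ := ((tendsto_len_cyl (hst α hα)).eventually (gt_mem_nhds hδ0)).exists
  have hcylE : S.cyl L α ⊆ E := by
    intro t ht
    have htI := cyl_subset_Icc L α ht
    refine ⟨max_le htI.1 ?_, htI.2⟩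
    have h := abs_sub_le_len (ordConnected_cyl (hst α hα L))
      (volume_ne_top_of_subset_Icc (cyl_subset_Icc L α)) ht
      (self_mem_cyl (hst α hα L) (mem_Icc_of_stays (hst α hα)))
    linarith [(abs_le.1 h).1]
  refine ⟨4 + L, fun L₀ => ⟨L₀ + L, by omega, y L₀, hyK L₀, ?_⟩⟩
  rw [lenSum_add, hy0]
  refine add_le_add ?_ (lenSum_le_self L α)
  calc ∑ i ∈ Finset.range L₀, volume.real (S.cyl (L₀ + L - (i + 1)) (S.T^[i + 1] (y L₀)))
      ≤ ∑ i ∈ Finset.range L₀, 2 * volume.real (G (L₀ - 1 - i)) := by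
        refine Finset.sum_le_sum fun i hi => ?_
        have hi' := Finset.mem_range.1 hi
        have h := hyiter (i + 1) (L₀ - 1 - i)
        rw [show L₀ - 1 - i + (i + 1) = L₀ by omega] at h
        rw [h, show L₀ + L - (i + 1) = L₀ - 1 - i + L by omega, cyl_add, hy0]
        refine (measureReal_mono (pull_mono hcylE) (volume_ne_top_of_subset_Icc
          (pull_subset_Icc (Icc_subset_Icc_left (le_max_left _ _))))).trans (hpull _)
    _ = 2 * ∑ i ∈ Finset.range L₀, volume.real (G i) := by
        rw [← Finset.mul_sum, Finset.sum_range_reflect fun n => volume.real (G n)]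
    _ ≤ 4 := by linarith [hsum L₀]

lemma exists_one_lt_abs_derIter_of_finite {B : Set (Set ℝ)} (hB : B.Finite) (hBN : B ⊆ S.Nfam)
    {x : ℝ} (hx : ∀ k, S.T^[k] x ∈ ⋃₀ B) : ∃ m, 1 < |derIter S.T m x| := by
  have hxst : ∀ n, S.Stays n x := fun n k _ => sUnion_subset_sUnion hBN (hx k)
  obtain ⟨K, hne, hK, hst, hmaps, hsurj, hvisit⟩ := exists_limit_set hB hBN hx
  suffices h : ∃ M, ∀ L₀, ∃ L ≥ L₀, ∃ y ∈ K, S.lenSum L y ≤ M by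
    obtain ⟨M, hM⟩ := h
    refine exists_one_lt_abs_derIter hxst (M := M) fun L₀ => ?_
    obtain ⟨L, hL, y, hy, hyM⟩ := hM L₀
    obtain ⟨i, hi⟩ := hvisit y hy L
    exact ⟨L, hL, i, (lenSum_eq_of_mem hi).trans_le hyM⟩
  by_cases hper : ∃ y ∈ K, ∃ q, 1 ≤ q ∧ S.T^[q] y = y
  · obtain ⟨y, hy, q, hq, hyq⟩ := hper
    obtain ⟨M, hM⟩ := exists_lenSum_le_of_periodic (hst y hy) hq hyq
    exact ⟨M, fun L₀ => ⟨L₀, le_rfl, y, hy, hM L₀⟩⟩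
  · push Not at hper
    exact exists_lenSum_le_of_no_periodic hne hK hst hmaps hsurj hper

/-! ### Uniform expansion -/

lemma isClosed_stays_le {B : Set (Set ℝ)} (hB : B.Finite) (hBN : B ⊆ S.Nfam) (n : ℕ) (c : ℝ) :
    IsClosed {x | (∀ k < n, S.T^[k] x ∈ ⋃₀ B) ∧ |derIter S.T n x| ≤ c} := by
  have hU : IsClosed (⋃₀ B) :=
    (hB.isCompact_sUnion fun J hJ => (S.hN J (hBN hJ)).1).isClosed
  have hUJ : ⋃₀ B ⊆ S.J := sUnion_subset_sUnion hBN
  have hder : ContinuousOn (deriv S.T) (⋃₀ B) := by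
    rw [sUnion_eq_iUnion]
    have := hB.to_subtype
    refine LocallyFinite.continuousOn_iUnion (locallyFinite_of_finite _)
      (fun J => (S.hN J (hBN J.2)).1.isClosed) fun J => (S.hdiffeo J (hBN J.2)).2.2
  have hcl : ∀ n, IsClosed {x | ∀ k < n, S.T^[k] x ∈ ⋃₀ B} := by
    intro n
    induction n with
    | zero => simp
    | succ n ih =>
      have heq : {x | ∀ k < n + 1, S.T^[k] x ∈ ⋃₀ B} =
          {x | ∀ k < n, S.T^[k] x ∈ ⋃₀ B} ∩ S.T^[n] ⁻¹' (⋃₀ B) := by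
        ext x
        simp only [mem_ofPred_eq, mem_inter_iff, mem_preimage, Nat.lt_succ_iff_lt_or_eq]
        constructor
        · exact fun h => ⟨fun k hk => h k (Or.inl hk), h n (Or.inr rfl)⟩
        · rintro ⟨h, h'⟩ k (hk | rfl)
          exacts [h k hk, h']
      rw [heq]
      refine ContinuousOn.preimage_isClosed_of_isClosed (fun x hx => ?_) ih hU
      exact (Stays.hasDerivAt (S := S) fun k hk => hUJ (hx k hk)).continuousAt.continuousWithinAt
  have hcont : ContinuousOn (fun x => |derIter S.T n x|) {x | ∀ k < n, S.T^[k] x ∈ ⋃₀ B} := by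
    refine ContinuousOn.abs (continuousOn_finsetProd _ fun k hk => ?_)
    have hk' := Finset.mem_range.1 hk
    refine hder.comp (fun x hx => ?_) fun x hx => hx k hk'
    exact (Stays.hasDerivAt (S := S) fun i hi =>
      hUJ (hx i (hi.trans hk'))).continuousAt.continuousWithinAt
  exact hcont.preimage_isClosed_of_isClosed (hcl n) isClosed_Iic

lemma exists_expanding_time_of_finite {B : Set (Set ℝ)} (hB : B.Finite) (hBN : B ⊆ S.Nfam) :
    ∃ N : ℕ, ∃ l > (1 : ℝ), ∀ x, (∀ k < N, S.T^[k] x ∈ ⋃₀ B) →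
      ∃ k ≤ N, l ≤ |derIter S.T k x| := by
  by_contra! h
  set c : ℕ → ℝ := fun n => 1 + 1 / ((n : ℝ) + 1) with hc
  have hc1 : ∀ n, 1 < c n := fun n => by
    have : (0 : ℝ) < 1 / ((n : ℝ) + 1) := by positivity
    linarith
  have hcanti : ∀ n, c (n + 1) ≤ c n := fun n => by
    simp only [hc]
    gcongr
    simp
  set X : ℕ → Set ℝ := fun n => ⋂ k ∈ Finset.range (n + 2),
    {x | (∀ i < k, S.T^[i] x ∈ ⋃₀ B) ∧ |derIter S.T k x| ≤ c n} with hX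
  have hcl : ∀ n, IsClosed (X n) := fun n =>
    isClosed_biInter fun k _ => isClosed_stays_le hB hBN k (c n)
  have hmem : ∀ n x, x ∈ X n ↔
      ∀ k < n + 2, (∀ i < k, S.T^[i] x ∈ ⋃₀ B) ∧ |derIter S.T k x| ≤ c n := fun n x => by
    simp [hX]
  obtain ⟨x, hx⟩ := IsCompact.nonempty_iInter_of_sequence_nonempty_isCompact_isClosed X
    (fun n x hx => (hmem n x).2 fun k hk => by
      obtain ⟨h1, h2⟩ := (hmem _ x).1 hx k (by omega)
      exact ⟨h1, h2.trans (hcanti n)⟩)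
    (fun n => by
      obtain ⟨x, hx, hx'⟩ := h (n + 1) (c n) (hc1 n)
      exact ⟨x, (hmem n x).2 fun k hk =>
        ⟨fun i hi => hx i (by omega), (hx' k (by omega)).le⟩⟩)
    ((hB.isCompact_sUnion fun J hJ => (S.hN J (hBN hJ)).1).of_isClosed_subset (hcl 0)
      fun x hx => ((hmem 0 x).1 hx 1 (by omega)).1 0 (by omega)) hcl
  rw [mem_iInter] at hx
  obtain ⟨m, hm⟩ := exists_one_lt_abs_derIter_of_finite hB hBN
    fun k => ((hmem k x).1 (hx k) (k + 1) (by omega)).1 k (by omega)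
  have hlim : Tendsto c atTop (nhds 1) := by
    simpa [hc] using tendsto_one_div_add_atTop_nhds_zero_nat.const_add (1 : ℝ)
  refine absurd hm (not_lt_of_ge (ge_of_tendsto hlim ?_))
  filter_upwards [eventually_ge_atTop m] with n hn
  exact ((hmem n x).1 (hx n) m (by omega)).2

lemma exists_expanding_time (S : InducedSetup) : ∃ N : ℕ, ∃ l > (1 : ℝ), ∀ x, S.Stays N x →
    ∃ k ≤ N, l ≤ |derIter S.T k x| := by
  obtain ⟨η, hη, hsmall⟩ := exists_two_le_abs_derIter S
  set B := {J ∈ S.Nfam | η ≤ volume.real J} with hBdef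
  have hBN : B ⊆ S.Nfam := fun J hJ => hJ.1
  have hB : B.Finite := finite_of_le_len hη
    (fun J hJ => ⟨(S.hN J hJ.1).1.measurableSet, (S.hN J hJ.1).2.2.2.trans Ioo_subset_Icc_self,
      hJ.2⟩) (S.hdisj.mono hBN)
  obtain ⟨N, l, hl, h⟩ := exists_expanding_time_of_finite hB hBN
  refine ⟨N, min l 2, lt_min hl one_lt_two, fun x hx => ?_⟩
  by_cases hall : ∀ k < N, S.T^[k] x ∈ ⋃₀ B
  · obtain ⟨k, hk, hk'⟩ := h x hall
    exact ⟨k, hk, (min_le_left _ _).trans hk'⟩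
  · push Not at hall
    classical
    obtain ⟨hkN, hk⟩ := Nat.find_spec hall
    refine ⟨Nat.find hall + 1, hkN, (min_le_right _ _).trans ?_⟩
    refine hsmall x _ (hx.mono hkN) (fun J hJ hJ' => lt_of_not_ge fun hle => hk ⟨J, ⟨hJ, hle⟩, hJ'⟩)
      fun i hi J hJ hJ' => ?_
    have hi' := Nat.find_min hall hi
    push Not at hi'
    obtain ⟨J', hJ'B, hiJ'⟩ := hi' (hi.trans hkN)
    rw [eq_of_mem hJ hJ'B.1 hJ' hiJ']
    exact hJ'B.2

lemma le_abs_derIter_of_expanding_time {N : ℕ} {κ : ℝ} (hκ : 1 < κ)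
    (h : ∀ x, S.Stays N x → ∃ k ≤ N, κ ^ N ≤ |derIter S.T k x|) (hN : 1 ≤ N) (n : ℕ) :
    ∀ x, S.Stays n x → ((1 + S.Dd)⁻¹) ^ N / κ ^ N * κ ^ n ≤ |derIter S.T n x| := by
  have hD := S.hDd
  have hκ0 : 0 < κ := by linarith
  induction n using Nat.strong_induction_on with
  | _ n ih =>
    intro x hx
    rcases lt_or_ge n N with hn | hn
    · refine le_trans ?_ hx.inv_pow_le_abs_derIter
      calc ((1 + S.Dd)⁻¹) ^ N / κ ^ N * κ ^ n ≤ ((1 + S.Dd)⁻¹) ^ N / κ ^ N * κ ^ N := by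
            gcongr
            exact hκ.le
        _ = ((1 + S.Dd)⁻¹) ^ N := div_mul_cancel₀ _ (by positivity)
        _ ≤ ((1 + S.Dd)⁻¹) ^ n := pow_le_pow_of_le_one (by positivity)
            (inv_le_one_of_one_le₀ (by linarith)) hn.le
    · obtain ⟨k, hk, hk'⟩ := h x (hx.mono hn)
      have hk0 : k ≠ 0 := by
        rintro rfl
        simp only [derIter, Finset.range_zero, Finset.prod_empty, abs_one] at hk'
        exact absurd (one_lt_pow₀ hκ (by omega : N ≠ 0)) (not_lt_of_ge hk')
      obtain ⟨m, rfl⟩ := Nat.exists_eq_add_of_le (hk.trans hn)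
      have h1 := ih m (by omega) _ hx.iterate
      rw [derIter_add, abs_mul]
      calc ((1 + S.Dd)⁻¹) ^ N / κ ^ N * κ ^ (k + m)
          = κ ^ k * (((1 + S.Dd)⁻¹) ^ N / κ ^ N * κ ^ m) := by ring
        _ ≤ κ ^ N * (((1 + S.Dd)⁻¹) ^ N / κ ^ N * κ ^ m) := by
            gcongr
            exact hκ.le
        _ ≤ _ := by gcongr

end InducedSetup

/-- **Theorem (Mañé's theorem for induced maps).** Under conditions (1)–(3), `T` is
hyperbolic: there are `C > 0` and `κ > 1` such that `|DT^n(x)| ≥ C κ^n` along any orbit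
segment `x, T(x), …, T^{n−1}(x)` contained in `𝒥`. -/
theorem mane_induced (S : InducedSetup) :
    ∃ C > (0 : ℝ), ∃ κ > (1 : ℝ), ∀ (x : ℝ) (n : ℕ), 1 ≤ n →
      (∀ k < n, S.T^[k] x ∈ S.J) → C * κ ^ n ≤ |derIter S.T n x| := by
  obtain ⟨N, l, hl, h⟩ := InducedSetup.exists_expanding_time S
  have hD := S.hDd
  have hN : 1 ≤ N + 1 := by omega
  set κ : ℝ := l ^ ((N + 1 : ℕ) : ℝ)⁻¹ with hκ
  have hκ1 : 1 < κ := Real.one_lt_rpow hl (by positivity)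
  have hκN : κ ^ (N + 1) = l := Real.rpow_inv_natCast_pow (by linarith) (by omega)
  refine ⟨((1 + S.Dd)⁻¹) ^ (N + 1) / κ ^ (N + 1), by positivity, κ, hκ1, fun x n _ hx =>
    InducedSetup.le_abs_derIter_of_expanding_time hκ1 (fun y hy => ?_) hN n x hx⟩
  obtain ⟨k, hk, hk'⟩ := h y (hy.mono (by omega))
  exact ⟨k, by omega, hκN.trans_le hk'⟩
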